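/- Poincaré–Birkhoff–Witt expansion of the canonical form, type B_r, chain part: let k∈ℕ^r with k_r ≤ 1. Then, in the quotient U/I, Σ_J ω_J · f_{J(|k|)} f_{J(|k|−1)} ⋯ f_{J(1)} = Σ_p ω_p · F^p, where J ranges over all multi-indices of content k and p ranges over all maps from the set of chain roots {γ_{ij} : 1≤i<j≤r+1} to ℕ with Σ p_{γ}·c(γ) = k. (The remaining positive roots ε_i+ε_j of B_r have content with entry 2 at position r and hence cannot contribute when k_r≤1.) -/

import Mathlib

open Finset
open scoped Classical

noncomputable section

/-- The set of variables `t⁽ⁱ⁾_a`, `1 ≤ i ≤ r`, `1 ≤ a ≤ k i`. -/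
abbrev SVars (r : ℕ) (k : Fin r → ℕ) := (i : Fin r) × Fin (k i)

/-- The field `K` of rational functions over `ℂ` in the variables `t⁽ⁱ⁾_a`. -/
abbrev RF (r : ℕ) (k : Fin r → ℕ) := FractionRing (MvPolynomial (SVars r k) ℂ)

/-- The variable `t⁽ⁱ⁾_a` as a rational function. -/
def Xv (r : ℕ) (k : Fin r → ℕ) (v : SVars r k) : RF r k :=
  algebraMap (MvPolynomial (SVars r k) ℂ) (RF r k) (MvPolynomial.X v)

/-- `posCount J u` is the number of `v < u` with the same color as `u`; under the
identification of the paper, `t_u = t^{(J(u))}_{posCount J u + 1}`. -/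
def posCount {r n : ℕ} (J : Fin n → Fin r) (u : Fin n) : ℕ :=
  (univ.filter fun v => J v = J u ∧ v < u).card

/-- The chain variable `t_u` (with `t_0 = 0`) as a rational function, after applying the
permutation `π ∈ G_k`. -/
def chainRF (r : ℕ) (k : Fin r → ℕ) {n : ℕ} (J : Fin n → Fin r)
    (π : ∀ i, Equiv.Perm (Fin (k i))) : ℕ → RF r k
  | 0 => 0
  | (u + 1) =>
    if h : u < n then
      if h2 : posCount J ⟨u, h⟩ < k (J ⟨u, h⟩) then
        Xv r k ⟨J ⟨u, h⟩, π (J ⟨u, h⟩) ⟨posCount J ⟨u, h⟩, h2⟩⟩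
      else 0
    else 0

/-- The canonical coefficient function
`ω_J = Σ_{π ∈ G_k} π·(∏_{u=1}^{n} 1/(t_u − t_{u−1}))` as a rational function. -/
def omegaRF (r : ℕ) (k : Fin r → ℕ) {n : ℕ} (J : Fin n → Fin r) : RF r k :=
  ∑ π : ∀ i, Equiv.Perm (Fin (k i)),
    ∏ u ∈ range n, (chainRF r k J π (u + 1) - chainRF r k J π u)⁻¹

/-- `J` is a multi-index of content `k`. -/
def IsContent (r : ℕ) {n : ℕ} (J : Fin n → Fin r) (k : Fin r → ℕ) : Prop :=
  ∀ i : Fin r, (univ.filter fun v => J v = i).card = k i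

/-- The free associative `K`-algebra `U` on the generators `f_1, …, f_r`. -/
abbrev FreeA (r : ℕ) (k : Fin r → ℕ) := FreeAlgebra (RF r k) (Fin r)

/-- The generator `f_{u+1}` (`0`-based index `u`). -/
def fgen (r : ℕ) (k : Fin r → ℕ) (u : ℕ) : FreeA r k :=
  if h : u < r then FreeAlgebra.ι (RF r k) ⟨u, h⟩ else 0

/-- The commutator `[a, b] = ab − ba`. -/
def lieBr {A : Type*} [Ring A] (a b : A) : A := a * b - b * a

/-- The iterated bracket `[f_{a_1}, [f_{a_2}, [… , f_{a_s}]…]]` (0-based indices). -/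
def listBracket (r : ℕ) (k : Fin r → ℕ) : List ℕ → FreeA r k
  | [] => 0
  | [a] => fgen r k a
  | a :: b :: l => lieBr (fgen r k a) (listBracket r k (b :: l))

/-- The monomial `f_{J(n)} f_{J(n−1)} ⋯ f_{J(1)}`. -/
def monJ (r : ℕ) (k : Fin r → ℕ) {n : ℕ} (J : Fin n → Fin r) : FreeA r k :=
  (List.ofFn fun u : Fin n => FreeAlgebra.ι (RF r k) (J u.rev)).prod

/-- The Serre elements of type `B_r` (0-based generator indices; node `r−1` is the short
root): `[f_a, f_b]` for `|a−b| ≥ 2`; `[f_a, [f_a, f_{a+1}]]` and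
`[f_{a+1}, [f_{a+1}, f_a]]` for `a + 3 ≤ r`; `[f_{r−2}, [f_{r−2}, f_{r−1}]]`; and
`[f_{r−1}, [f_{r−1}, [f_{r−1}, f_{r−2}]]]`. -/
def serreB (r : ℕ) (k : Fin r → ℕ) : Set (FreeA r k) :=
  {x | ∃ a b : Fin r, ((a : ℕ) + 2 ≤ (b : ℕ) ∨ (b : ℕ) + 2 ≤ (a : ℕ)) ∧
      x = lieBr (FreeAlgebra.ι (RF r k) a) (FreeAlgebra.ι (RF r k) b)} ∪
  {x | ∃ a : ℕ, a + 3 ≤ r ∧ x = lieBr (fgen r k a) (lieBr (fgen r k a) (fgen r k (a + 1)))} ∪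
  {x | ∃ a : ℕ, a + 3 ≤ r ∧
      x = lieBr (fgen r k (a + 1)) (lieBr (fgen r k (a + 1)) (fgen r k a))} ∪
  {lieBr (fgen r k (r - 2)) (lieBr (fgen r k (r - 2)) (fgen r k (r - 1)))} ∪
  {lieBr (fgen r k (r - 1))
    (lieBr (fgen r k (r - 1)) (lieBr (fgen r k (r - 1)) (fgen r k (r - 2))))}

/-- The chain roots of `B_r`: `γ_{ij} = α_i + … + α_{j−1}` for `1 ≤ i < j ≤ r+1`
(0-based: pairs `0 ≤ i < j ≤ r`). -/
abbrev RootB (r : ℕ) := {q : Fin (r + 1) × Fin (r + 1) // q.1 < q.2}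

/-- The content of `γ_{ij}`: the indicator of `{i, …, j−1}`. -/
def contB (r : ℕ) (β : RootB r) : Fin r → ℕ :=
  fun u => if (β.1.1 : ℕ) ≤ (u : ℕ) ∧ (u : ℕ) < (β.1.2 : ℕ) then 1 else 0

/-- The order on the chain roots: `γ_{ij} < γ_{i'j'}` iff `i > i'`, or `i = i'` and
`j > j'`. -/
def beforeB (r : ℕ) (β β' : RootB r) : Prop :=
  (β'.1.1 : ℕ) < (β.1.1 : ℕ) ∨ ((β.1.1 : ℕ) = (β'.1.1 : ℕ) ∧ (β'.1.2 : ℕ) < (β.1.2 : ℕ))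

/-- The offset of the color-`u` block of variables of the `c`-th copy of `η_γ` inside
the star product defining `ω_p`. -/
def offB (r : ℕ) (p : RootB r → ℕ) (β : RootB r) (c : ℕ) (u : Fin r) : ℕ :=
  (∑ β' ∈ univ.filter (fun x => beforeB r x β), p β' * contB r β' u) + c * contB r β u

/-- The variable lookup for the `c`-th copy of the factor `η_β` in `ω_p` (1-based color
`u` and lower index `a`), after the global permutation `π ∈ G_k`. -/
def tvB (r : ℕ) (k : Fin r → ℕ) (p : RootB r → ℕ) (π : ∀ i, Equiv.Perm (Fin (k i)))
    (β : RootB r) (c : ℕ) (u a : ℕ) : RF r k :=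
  if h : u - 1 < r then
    if h2 : offB r p β c ⟨u - 1, h⟩ + (a - 1) < k ⟨u - 1, h⟩ then
      Xv r k ⟨⟨u - 1, h⟩, π ⟨u - 1, h⟩ ⟨offB r p β c ⟨u - 1, h⟩ + (a - 1), h2⟩⟩
    else 0
  else 0

/-- The function `η_{γ_{ij}} = 1/(t⁽ʲ⁻¹⁾(t⁽ʲ⁻¹⁾−t⁽ʲ⁻²⁾)⋯(t⁽ⁱ⁺¹⁾−t⁽ⁱ⁾))` (1-based
indices), evaluated on the variables of the `c`-th copy of the factor `η_β` of `ω_p`. -/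
def etaB (r : ℕ) (k : Fin r → ℕ) (p : RootB r → ℕ) (π : ∀ i, Equiv.Perm (Fin (k i)))
    (β : RootB r) (c : ℕ) : RF r k :=
  (tvB r k p π β c (β.1.2 : ℕ) 1)⁻¹ *
    ∏ u ∈ Finset.Icc ((β.1.1 : ℕ) + 1) ((β.1.2 : ℕ) - 1),
      (tvB r k p π β c (u + 1) 1 - tvB r k p π β c u 1)⁻¹

/-- The coefficient `ω_p = (1/∏_γ p_γ!)·(star product of `p_γ` copies of `η_γ` over the
chain roots in increasing order)`, written out as a single symmetrization. -/
def omegaP (r : ℕ) (k : Fin r → ℕ) (p : RootB r → ℕ) : RF r k :=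
  ((∏ β : RootB r, (p β).factorial : ℕ) : RF r k)⁻¹ *
    ∑ π : ∀ i, Equiv.Perm (Fin (k i)),
      ∏ β : RootB r, ∏ c ∈ range (p β), etaB r k p π β c

/-- `p γ` read off from the 0-based pair `(i, j)`. -/
def pAtB (r : ℕ) (p : RootB r → ℕ) (i j : ℕ) : ℕ :=
  if h : i < r + 1 ∧ j < r + 1 ∧ i < j then
    p ⟨(⟨i, h.1⟩, ⟨j, h.2.1⟩), by exact Fin.mk_lt_mk.mpr h.2.2⟩
  else 0

/-- The PBW monomial `F^p`: the product of the `F_γ^{p_γ}` over the chain roots in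
increasing order (smallest leftmost), `F_{γ_{ij}} = [f_{j−1},[f_{j−2},[…,f_i]…]]`. -/
def FpowB (r : ℕ) (k : Fin r → ℕ) (p : RootB r → ℕ) : FreeA r k :=
  (((List.range r).reverse).map fun i =>
    (((List.range' (i + 1) (r - i)).reverse).map fun j =>
      listBracket r k ((List.range' i (j - i)).reverse) ^ pAtB r p i j).prod).prod

section ChainVectors

variable {A : Type*} [Ring A]

theorem commute_iff_lieBr {a b : A} : Commute a b ↔ lieBr a b = 0 := by
  unfold lieBr
  rw [sub_eq_zero]
  exact Iff.rfl

theorem Commute.lieBr_right' {x a b : A} (ha : Commute x a) (hb : Commute x b) :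
    Commute x (lieBr a b) :=
  (ha.mul_right hb).sub_right (hb.mul_right ha)

/-- The iterated bracket `[g_{i+m}, [g_{i+m-1}, [… , g_i]…]]`. -/
def chainVec (g : ℕ → A) (i : ℕ) : ℕ → A
  | 0 => g i
  | m + 1 => lieBr (g (i + m + 1)) (chainVec g i m)

/-- The Serre relations of type `A`, for a sequence of elements of a ring. -/
structure IsSerreA (g : ℕ → A) : Prop where
  far : ∀ a b, a + 2 ≤ b → Commute (g a) (g b)
  up : ∀ a, Commute (g a) (lieBr (g a) (g (a + 1)))
  down : ∀ a, Commute (g (a + 1)) (lieBr (g (a + 1)) (g a))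

variable {g : ℕ → A}

theorem IsSerreA.commute_above (hg : IsSerreA g) {i m a : ℕ} (h : i + m + 2 ≤ a) :
    Commute (g a) (chainVec g i m) := by
  induction m with
  | zero => exact (hg.far _ _ (by omega)).symm
  | succ m ih =>
    exact Commute.lieBr_right' (hg.far _ _ (by omega)).symm (ih (by omega))

theorem IsSerreA.commute_last (hg : IsSerreA g) (i m : ℕ) :
    Commute (g (i + m + 1)) (chainVec g i (m + 1)) := by
  cases m with
  | zero => exact hg.down i
  | succ m =>
    have h1 := hg.commute_above (i := i) (m := m) (a := i + m + 1 + 1) (by omega)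
    have h2 := hg.down (i + m + 1)
    change Commute _ (lieBr _ (lieBr _ _))
    rw [show i + (m + 1) + 1 = i + m + 1 + 1 by ring]
    generalize chainVec g i m = X at *
    generalize g (i + m + 1 + 1) = a at *
    generalize g (i + m + 1) = b at *
    have e : lieBr a (lieBr b X) = lieBr (lieBr a b) X := by
      have jac : lieBr a (lieBr b X) = lieBr (lieBr a b) X + lieBr b (lieBr a X) := by
        simp only [lieBr]
        noncomm_ring
      rw [jac, commute_iff_lieBr.1 h1]
      simp [lieBr]
    rw [e]
    exact Commute.lieBr_right' h2 h1

theorem IsSerreA.commute_first (hg : IsSerreA g) (i m : ℕ) :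
    Commute (g i) (chainVec g i (m + 1)) := by
  induction m with
  | zero =>
    have := hg.up i
    have e : chainVec g i 1 = - lieBr (g i) (g (i + 1)) := by
      simp [chainVec, lieBr]
    rw [e]
    exact this.neg_right
  | succ m ih => exact Commute.lieBr_right' (hg.far _ _ (by omega)) ih

theorem IsSerreA.commute_inner (h2 : ∀ z : A, z + z = 0 → z = 0) (hg : IsSerreA g)
    {i m a : ℕ} (hi : i < a) (ha : a < i + m) : Commute (g a) (chainVec g i m) := by
  obtain ⟨d, rfl⟩ := Nat.exists_eq_add_of_lt hi
  obtain ⟨n, rfl⟩ : ∃ n, m = d + 2 + n := ⟨m - (d + 2), by omega⟩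
  clear hi ha
  induction n with
  | zero =>
    have hY := hg.commute_above (i := i) (m := d) (a := i + d + 1 + 1) (by omega)
    have hZ : Commute (g (i + d + 1)) (lieBr (g (i + d + 1)) (chainVec g i d)) :=
      hg.commute_last i d
    have hU := hg.up (i + d + 1)
    change Commute _ (lieBr (g (i + d + 1 + 1)) (lieBr (g (i + d + 1)) (chainVec g i d)))
    generalize chainVec g i d = Y at *
    generalize g (i + d + 1 + 1) = b at *
    generalize g (i + d + 1) = a at *
    rw [commute_iff_lieBr]
    apply h2
    have hY' := hY.eq
    have hZ' := commute_iff_lieBr.1 hZ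
    have hU' := commute_iff_lieBr.1 hU
    have k0 : b * Y - Y * b = 0 := by rw [hY', sub_self]
    have key : lieBr a (lieBr b (lieBr a Y)) + lieBr a (lieBr b (lieBr a Y)) =
        lieBr a (lieBr a (lieBr b Y)) + lieBr b (lieBr a (lieBr a Y))
          - lieBr (lieBr a (lieBr a b)) Y := by
      simp only [lieBr]
      noncomm_ring
    rw [key, hZ', hU', show lieBr b Y = 0 from k0]
    simp [lieBr]
  | succ n ih =>
    rw [← add_assoc]
    exact Commute.lieBr_right' (hg.far _ _ (by omega)) ih

theorem IsSerreA.commute_of_ne (h2 : ∀ z : A, z + z = 0 → z = 0) (hg : IsSerreA g)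
    {i m a : ℕ} (hi : i < a) (ha : a ≠ i + m + 1) : Commute (g a) (chainVec g i m) := by
  rcases lt_trichotomy a (i + m) with h | h | h
  · exact hg.commute_inner h2 hi h
  · obtain ⟨n, rfl⟩ : ∃ n, m = n + 1 := ⟨m - 1, by omega⟩
    subst h
    exact hg.commute_last i n
  · exact hg.commute_above (by omega)

theorem IsSerreA.commute_chainVec_of_lt (h2 : ∀ z : A, z + z = 0 → z = 0) (hg : IsSerreA g)
    {i m m' : ℕ} (h : m < m') : Commute (chainVec g i m) (chainVec g i m') := by
  induction m with
  | zero =>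
    obtain ⟨n, rfl⟩ : ∃ n, m' = n + 1 := ⟨m' - 1, by omega⟩
    exact hg.commute_first i n
  | succ m ih =>
    exact (Commute.lieBr_right' (hg.commute_of_ne h2 (by omega) (by omega)).symm
      (ih (by omega)).symm).symm

theorem IsSerreA.commute_chainVec (h2 : ∀ z : A, z + z = 0 → z = 0) (hg : IsSerreA g)
    (i m m' : ℕ) : Commute (chainVec g i m) (chainVec g i m') := by
  rcases lt_trichotomy m m' with h | rfl | h
  · exact hg.commute_chainVec_of_lt h2 h
  · exact Commute.refl _
  · exact (hg.commute_chainVec_of_lt h2 h).symm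

/-- The ordered product `F_{i,n-1}^{p_{i,n-1}} ⋯ F_{i,0}^{p_{i,0}}` with `F = chainVec g`. -/
def blockPow (g : ℕ → A) (p : ℕ → ℕ → ℕ) (i : ℕ) : ℕ → A
  | 0 => 1
  | n + 1 => chainVec g i n ^ p i n * blockPow g p i n

/-- The ordered product of the blocks `m-1, …, 0` of the PBW monomial with exponents `p`. -/
def pbwPow (g : ℕ → A) (r : ℕ) (p : ℕ → ℕ → ℕ) : ℕ → A
  | 0 => 1
  | m + 1 => blockPow g p m (r - m) * pbwPow g r p m

/-- Replace one factor `(i, d)` by one factor `(i, d + 1)`. -/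
def lengthen (p : ℕ → ℕ → ℕ) (i d : ℕ) : ℕ → ℕ → ℕ := fun x m =>
  if x = i ∧ m = d then p x m - 1 else if x = i ∧ m = d + 1 then p x m + 1 else p x m

/-- Add one factor `(a, 0)`. -/
def addSimple (p : ℕ → ℕ → ℕ) (a : ℕ) : ℕ → ℕ → ℕ := fun x m =>
  if x = a ∧ m = 0 then p x m + 1 else p x m

theorem blockPow_congr {p p' : ℕ → ℕ → ℕ} {i n : ℕ} (h : ∀ m < n, p i m = p' i m) :
    blockPow g p i n = blockPow g p' i n := by
  induction n with
  | zero => rfl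
  | succ n ih =>
    simp only [blockPow]
    rw [h n (by omega), ih fun m hm => h m (by omega)]

theorem pbwPow_congr {r : ℕ} {p p' : ℕ → ℕ → ℕ} {n : ℕ}
    (h : ∀ i < n, ∀ m < r - i, p i m = p' i m) :
    pbwPow g r p n = pbwPow g r p' n := by
  induction n with
  | zero => rfl
  | succ n ih =>
    simp only [pbwPow]
    rw [blockPow_congr (h n (by omega)), ih fun i hi => h i (by omega)]

theorem commute_blockPow {x : A} {p : ℕ → ℕ → ℕ} {i n : ℕ}
    (h : ∀ m < n, Commute x (chainVec g i m)) : Commute x (blockPow g p i n) := by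
  induction n with
  | zero => exact Commute.one_right _
  | succ n ih =>
    exact ((h n (by omega)).pow_right _).mul_right (ih fun m hm => h m (by omega))

theorem pow_mul_eq_of_commute_lieBr {x f : A} (h : Commute (lieBr x f) f) (n : ℕ) :
    f ^ n * x = x * f ^ n - n • (lieBr x f * f ^ (n - 1)) := by
  induction n with
  | zero => simp
  | succ n ih =>
    have e : f * x = x * f - lieBr x f := by simp [lieBr]
    have e2 : n • (f * (lieBr x f * f ^ (n - 1))) = n • (lieBr x f * f ^ n) := by
      cases n with
      | zero => simp
      | succ n =>
        rw [← mul_assoc, ← h.eq, mul_assoc]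
        simp [pow_succ']
    rw [pow_succ', mul_assoc, ih, mul_sub, ← mul_assoc, e, sub_mul, mul_smul_comm, e2]
    simp only [Nat.add_sub_cancel, add_smul, one_smul, mul_assoc, ← pow_succ']
    abel

theorem IsSerreA.blockPow_mul (h2 : ∀ z : A, z + z = 0 → z = 0) (hg : IsSerreA g)
    (p : ℕ → ℕ → ℕ) {i d n : ℕ} (h : d + 2 ≤ n) :
    blockPow g p i n * g (i + d + 1) = g (i + d + 1) * blockPow g p i n -
      p i d • blockPow g (lengthen p i d) i n := by
  induction n, h using Nat.le_induction with
  | base =>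
    have hc : Commute (g (i + d + 1)) (blockPow g p i d) :=
      commute_blockPow fun m hm => hg.commute_of_ne h2 (by omega) (by omega)
    have hl : Commute (g (i + d + 1)) (chainVec g i (d + 1)) := hg.commute_last i d
    have hp := pow_mul_eq_of_commute_lieBr (x := g (i + d + 1)) (f := chainVec g i d)
      (hg.commute_chainVec h2 i (d + 1) d) (p i d)
    change _ = _ - _ • (chainVec g i (d + 1) * _) at hp
    have e : blockPow g (lengthen p i d) i d = blockPow g p i d :=
      blockPow_congr fun m hm => by
        simp only [lengthen]
        rw [if_neg (by omega), if_neg (by omega)]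
    simp only [blockPow, e]
    have e1 : lengthen p i d i d = p i d - 1 := by simp [lengthen]
    have e2 : lengthen p i d i (d + 1) = p i (d + 1) + 1 := by simp [lengthen]
    rw [e1, e2]
    calc _ = chainVec g i (d + 1) ^ p i (d + 1) *
          ((chainVec g i d ^ p i d * g (i + d + 1)) * blockPow g p i d) := by
          rw [mul_assoc, mul_assoc, ← hc.eq, mul_assoc]
      _ = _ := by
          rw [hp, sub_mul, mul_sub, mul_assoc, ← mul_assoc _ (g (i + d + 1)),
            ← (hl.pow_right _).eq, smul_mul_assoc, mul_smul_comm, pow_succ]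
          simp only [mul_assoc]
  | succ n hn ih =>
    have hc : Commute (g (i + d + 1)) (chainVec g i n) :=
      hg.commute_of_ne h2 (by omega) (by omega)
    have e : lengthen p i d i n = p i n := by
      simp only [lengthen]
      rw [if_neg (by omega), if_neg (by omega)]
    simp only [blockPow, e]
    rw [mul_assoc, ih, mul_sub, ← mul_assoc, ← (hc.pow_right _).eq, mul_smul_comm, mul_assoc]

theorem IsSerreA.pbwPow_mul_of_le (h2 : ∀ z : A, z + z = 0 → z = 0) (hg : IsSerreA g)
    (r : ℕ) (p : ℕ → ℕ → ℕ) {a n : ℕ} (hn : n ≤ a) (ha : a < r) :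
    pbwPow g r p n * g a = g a * pbwPow g r p n -
      ∑ i ∈ range n, p i (a - i - 1) • pbwPow g r (lengthen p i (a - i - 1)) n := by
  induction n with
  | zero => simp [pbwPow]
  | succ n ih =>
    obtain ⟨d, rfl⟩ : ∃ d, a = n + d + 1 := ⟨a - n - 1, by omega⟩
    rw [sum_range_succ]
    simp only [pbwPow]
    have e0 : n + d + 1 - n - 1 = d := by omega
    rw [mul_assoc, ih (by omega), mul_sub, ← mul_assoc,
      hg.blockPow_mul h2 p (by omega), sub_mul, mul_assoc, e0, mul_sum, smul_mul_assoc]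
    have e1 : pbwPow g r (lengthen p n d) n = pbwPow g r p n :=
      pbwPow_congr fun i hi m _ => by
        simp only [lengthen]
        rw [if_neg (by omega), if_neg (by omega)]
    have e2 : ∀ i ∈ range n, blockPow g p n (r - n) *
        (p i (n + d + 1 - i - 1) • pbwPow g r (lengthen p i (n + d + 1 - i - 1)) n) =
        p i (n + d + 1 - i - 1) •
        (blockPow g (lengthen p i (n + d + 1 - i - 1)) n (r - n) *
          pbwPow g r (lengthen p i (n + d + 1 - i - 1)) n) := by
      intro i hi
      rw [mem_range] at hi
      rw [mul_smul_comm]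
      congr 2
      exact blockPow_congr fun m _ => by
        simp only [lengthen]
        rw [if_neg (by omega), if_neg (by omega)]
    rw [sum_congr rfl e2, e1]
    abel

theorem blockPow_mul_simple (p : ℕ → ℕ → ℕ) (a n : ℕ) :
    blockPow g p a (n + 1) * g a = blockPow g (addSimple p a) a (n + 1) := by
  induction n with
  | zero => simp [blockPow, addSimple, chainVec, pow_succ]
  | succ n ih =>
    have e : addSimple p a a (n + 1) = p a (n + 1) := by simp [addSimple]
    rw [blockPow, mul_assoc, ih, blockPow.eq_2 g (addSimple p a) a (n + 1), e]

/-- Right multiplication of a PBW monomial by a generator. -/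
theorem IsSerreA.pbwPow_mul (h2 : ∀ z : A, z + z = 0 → z = 0) (hg : IsSerreA g)
    (r : ℕ) (p : ℕ → ℕ → ℕ) {a n : ℕ} (hn : a < n) (ha : a < r) :
    pbwPow g r p n * g a = pbwPow g r (addSimple p a) n -
      ∑ i ∈ range a, p i (a - i - 1) • pbwPow g r (lengthen p i (a - i - 1)) n := by
  have key : ∀ n, a < n → ∀ i ∈ range a,
      blockPow g (lengthen p i (a - i - 1)) n (r - n) = blockPow g p n (r - n) := by
    intro n hn i hi
    rw [mem_range] at hi
    exact blockPow_congr fun m _ => by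
      simp only [lengthen]
      rw [if_neg (by omega), if_neg (by omega)]
  induction n, hn using Nat.le_induction with
  | base =>
    simp only [pbwPow]
    obtain ⟨n, hn⟩ : ∃ n, r - a = n + 1 := ⟨r - a - 1, by omega⟩
    rw [mul_assoc, hg.pbwPow_mul_of_le h2 r p le_rfl ha, mul_sub, ← mul_assoc, hn,
      blockPow_mul_simple, mul_sum]
    congr 1
    · congr 1
      exact pbwPow_congr fun i hi m _ => by
        simp only [addSimple]
        rw [if_neg (by omega)]
    · refine sum_congr rfl fun i hi => ?_
      rw [mul_smul_comm]
      congr 2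
      rw [mem_range] at hi
      exact blockPow_congr fun m _ => by
        simp only [lengthen]
        rw [if_neg (by omega), if_neg (by omega)]
  | succ n hn ih =>
    simp only [pbwPow]
    rw [mul_assoc, ih, mul_sub, mul_sum]
    congr 1
    · congr 1
      exact blockPow_congr fun m _ => by
        simp only [addSimple]
        rw [if_neg (by omega)]
    · refine sum_congr rfl fun i hi => ?_
      rw [mul_smul_comm, key n hn i hi]

end ChainVectors

section ChainPartitions

variable {V : Type*}

/-- `q` describes a partition of `W` into chains whose colors descend by one: `q v` is the
element following `v` in its chain, if there is one. -/
structure IsChainPart (col : V → ℕ) (W : Finset V) (q : V → Option V) : Prop where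
  mem : ∀ v u, q v = some u → v ∈ W ∧ u ∈ W ∧ col v = col u + 1
  inj : ∀ v w u, q v = some u → q w = some u → v = w

/-- The first elements of the chains. -/
def tops (W : Finset V) (q : V → Option V) : Finset V :=
  W.filter fun u => ∀ v, q v ≠ some u

/-- Follow a chain for at most `n` steps and return the last color seen. -/
def bottomAux (col : V → ℕ) (q : V → Option V) : ℕ → V → ℕ
  | 0, v => col v
  | n + 1, v => (q v).elim (col v) (bottomAux col q n)

/-- The color of the last element of the chain of `v`. -/
def bottom (col : V → ℕ) (q : V → Option V) (v : V) : ℕ := bottomAux col q (col v) v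

/-- The number of chains with last color `i` and first color `i + m`. -/
def chainCount (col : V → ℕ) (W : Finset V) (q : V → Option V) (i m : ℕ) : ℕ :=
  ((tops W q).filter fun v => bottom col q v = i ∧ col v = i + m).card

variable {col : V → ℕ} {W : Finset V} {q : V → Option V} {v : V}

theorem mem_tops {u : V} : u ∈ tops W q ↔ u ∈ W ∧ ∀ v, q v ≠ some u := by
  simp [tops]

theorem bottom_of_eq_none (h : q v = none) : bottom col q v = col v := by
  unfold bottom
  cases h' : col v <;> simp [bottomAux, h, h']

theorem IsChainPart.bottom_of_eq_some (hq : IsChainPart col W q) {u : V} (h : q v = some u) :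
    bottom col q v = bottom col q u := by
  unfold bottom
  rw [(hq.mem _ _ h).2.2]
  simp [bottomAux, h]

theorem IsChainPart.bottom_le (hq : IsChainPart col W q) (v : V) : bottom col q v ≤ col v := by
  induction h : col v generalizing v with
  | zero => simp [bottom, h, bottomAux]
  | succ n ih =>
    cases hv : q v with
    | none => rw [bottom_of_eq_none hv, h]
    | some u =>
      rw [hq.bottom_of_eq_some hv]
      have := (hq.mem _ _ hv).2.2
      exact (ih u (by omega)).trans (by omega)

theorem bottomAux_update (hv : ∀ w, q w ≠ some v) (x : Option V) (n : ℕ) {w : V} (hw : w ≠ v) :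
    bottomAux col (Function.update q v x) n w = bottomAux col q n w := by
  induction n generalizing w with
  | zero => rfl
  | succ n ih =>
    simp only [bottomAux, Function.update_of_ne hw]
    cases h : q w with
    | none => rfl
    | some u =>
      exact ih fun e => hv w (by rw [h, e])

theorem bottom_update (hv : ∀ w, q w ≠ some v) (x : Option V) {w : V} (hw : w ≠ v) :
    bottom col (Function.update q v x) w = bottom col q w :=
  bottomAux_update hv x _ hw

theorem IsChainPart.ne_some_of_notMem (hq : IsChainPart col (W.erase v) q) (w : V) :
    q w ≠ some v := fun h => by
  simpa using (hq.mem _ _ h).2.1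

theorem IsChainPart.eq_none_of_notMem (hq : IsChainPart col (W.erase v) q) : q v = none := by
  cases h : q v with
  | none => rfl
  | some u => simpa using (hq.mem _ _ h).1

theorem IsChainPart.erase (hq : IsChainPart col W q) (hv : v ∈ tops W q) :
    IsChainPart col (W.erase v) (Function.update q v none) where
  mem a b h := by
    rcases eq_or_ne a v with rfl | hne
    · simp at h
    · rw [Function.update_of_ne hne] at h
      obtain ⟨h1, h2, h3⟩ := hq.mem _ _ h
      refine ⟨mem_erase.2 ⟨hne, h1⟩, mem_erase.2 ⟨?_, h2⟩, h3⟩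
      rintro rfl
      exact (mem_tops.1 hv).2 _ h
  inj a b u h h' := by
    rcases eq_or_ne a v with rfl | hne
    · simp at h
    rcases eq_or_ne b v with rfl | hne'
    · simp at h'
    rw [Function.update_of_ne hne] at h
    rw [Function.update_of_ne hne'] at h'
    exact hq.inj _ _ _ h h'

theorem IsChainPart.mem_tops_erase (hq : IsChainPart col W q) {u : V} (hu : q v = some u) :
    u ∈ tops (W.erase v) (Function.update q v none) := by
  obtain ⟨h1, h2, h3⟩ := hq.mem _ _ hu
  refine mem_tops.2 ⟨mem_erase.2 ⟨?_, h2⟩, fun w hw => ?_⟩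
  · rintro rfl
    omega
  · rcases eq_or_ne w v with rfl | hne
    · simp at hw
    · rw [Function.update_of_ne hne] at hw
      exact hne (hq.inj _ _ _ hw hu)

theorem IsChainPart.update (hq : IsChainPart col (W.erase v) q) (hv : v ∈ W) {x : Option V}
    (hx : ∀ u, x = some u → u ∈ tops (W.erase v) q ∧ col v = col u + 1) :
    IsChainPart col W (Function.update q v x) where
  mem a b h := by
    rcases eq_or_ne a v with rfl | hne
    · rw [Function.update_self] at h
      obtain ⟨h1, h2⟩ := hx _ h
      exact ⟨hv, mem_of_mem_erase (mem_tops.1 h1).1, h2⟩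
    · rw [Function.update_of_ne hne] at h
      obtain ⟨h1, h2, h3⟩ := hq.mem _ _ h
      exact ⟨mem_of_mem_erase h1, mem_of_mem_erase h2, h3⟩
  inj a b u h h' := by
    rcases eq_or_ne a v with rfl | hne
    · rcases eq_or_ne b a with rfl | hne'
      · rfl
      · rw [Function.update_self] at h
        rw [Function.update_of_ne hne'] at h'
        exact absurd h' ((mem_tops.1 (hx _ h).1).2 b)
    · rw [Function.update_of_ne hne] at h
      rcases eq_or_ne b v with rfl | hne'
      · rw [Function.update_self] at h'
        exact absurd h ((mem_tops.1 (hx _ h').1).2 a)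
      · rw [Function.update_of_ne hne'] at h'
        exact hq.inj _ _ _ h h'

theorem IsChainPart.tops_update (hq : IsChainPart col (W.erase v) q) (hv : v ∈ W) {x : Option V}
    (hx : ∀ u, x = some u → u ∈ tops (W.erase v) q ∧ col v = col u + 1) :
    tops W (Function.update q v x) =
      insert v ((tops (W.erase v) q).filter fun u => x ≠ some u) := by
  ext u
  simp only [mem_tops, mem_insert, mem_filter, mem_erase]
  constructor
  · rintro ⟨h1, h2⟩
    rcases eq_or_ne u v with rfl | hne
    · exact Or.inl rfl
    · refine Or.inr ⟨⟨⟨hne, h1⟩, fun w hw => ?_⟩, fun h => h2 v (by rw [Function.update_self, h])⟩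
      have := h2 w
      rcases eq_or_ne w v with rfl | hne'
      · rw [hq.eq_none_of_notMem] at hw
        simp at hw
      · rw [Function.update_of_ne hne'] at this
        exact this hw
  · rintro (rfl | ⟨⟨⟨h1, h2⟩, h3⟩, h4⟩)
    · refine ⟨hv, fun w hw => ?_⟩
      rcases eq_or_ne w u with rfl | hne'
      · rw [Function.update_self] at hw
        have := (hx _ hw).2
        omega
      · rw [Function.update_of_ne hne'] at hw
        exact hq.ne_some_of_notMem _ hw
    · refine ⟨h2, fun w hw => ?_⟩
      rcases eq_or_ne w v with rfl | hne'
      · rw [Function.update_self] at hw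
        exact h4 hw
      · rw [Function.update_of_ne hne'] at hw
        exact h3 _ hw

theorem notMem_tops_erase : v ∉ tops (W.erase v) q := fun h => by
  simpa using (mem_tops.1 h).1

theorem IsChainPart.chainCount_update_none (hq : IsChainPart col (W.erase v) q) (hv : v ∈ W) :
    chainCount col W (Function.update q v none) =
      addSimple (chainCount col (W.erase v) q) (col v) := by
  have hb : bottom col (Function.update q v none) v = col v := bottom_of_eq_none (by simp)
  have hf : ∀ i m, ((tops (W.erase v) q).filter fun u =>
      bottom col (Function.update q v none) u = i ∧ col u = i + m) =
      ((tops (W.erase v) q).filter fun u => bottom col q u = i ∧ col u = i + m) := by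
    intro i m
    refine filter_congr fun u hu => ?_
    rw [bottom_update hq.ne_some_of_notMem]
    rintro rfl
    exact notMem_tops_erase hu
  have ht : ((tops (W.erase v) q).filter fun u => none ≠ some u) = tops (W.erase v) q :=
    filter_true_of_mem (by simp)
  ext i m
  simp only [chainCount, addSimple]
  rw [hq.tops_update hv (by simp), ht, filter_insert, hb, hf]
  by_cases h : i = col v ∧ m = 0
  · obtain ⟨rfl, rfl⟩ := h
    rw [if_pos (by simp), if_pos (by simp), card_insert_of_notMem]
    exact fun h => notMem_tops_erase (mem_filter.1 h).1
  · rw [if_neg (by omega), if_neg h]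

theorem IsChainPart.chainCount_update_some (hq : IsChainPart col (W.erase v) q) (hv : v ∈ W)
    {u : V} (hu : u ∈ tops (W.erase v) q) (hc : col v = col u + 1) :
    chainCount col W (Function.update q v (some u)) =
      lengthen (chainCount col (W.erase v) q) (bottom col q u) (col v - bottom col q u - 1) := by
  have hx : ∀ w, some u = some w → w ∈ tops (W.erase v) q ∧ col v = col w + 1 := by
    rintro w h
    cases h
    exact ⟨hu, hc⟩
  have hq' := hq.update hv hx
  have huv : u ≠ v := by
    rintro rfl
    omega
  have hb : bottom col (Function.update q v (some u)) v = bottom col q u := by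
    rw [hq'.bottom_of_eq_some (Function.update_self ..), bottom_update hq.ne_some_of_notMem _ huv]
  have hle := hq.bottom_le u
  have hf : ∀ i m, (((tops (W.erase v) q).filter fun w => some u ≠ some w).filter fun w =>
      bottom col (Function.update q v (some u)) w = i ∧ col w = i + m) =
      ((tops (W.erase v) q).filter fun w => bottom col q w = i ∧ col w = i + m).erase u := by
    intro i m
    ext w
    simp only [mem_filter, mem_erase, ne_eq, Option.some_inj]
    constructor
    · rintro ⟨⟨h1, h2⟩, h3⟩
      rw [bottom_update hq.ne_some_of_notMem _ (by rintro rfl; exact notMem_tops_erase h1)] at h3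
      exact ⟨fun h => h2 h.symm, h1, h3⟩
    · rintro ⟨h2, h1, h3⟩
      rw [bottom_update hq.ne_some_of_notMem _ (by rintro rfl; exact notMem_tops_erase h1)]
      exact ⟨⟨h1, fun h => h2 h.symm⟩, h3⟩
  ext i m
  simp only [chainCount, lengthen]
  rw [hq.tops_update hv hx, filter_insert, hb, hf]
  by_cases h : i = bottom col q u ∧ m = col v - bottom col q u - 1
  · rw [if_neg (by omega), if_pos h, card_erase_of_mem]
    rw [mem_filter]
    exact ⟨hu, by omega, by omega⟩
  · have he : ((tops (W.erase v) q).filter fun w => bottom col q w = i ∧ col w = i + m).erase u =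
        (tops (W.erase v) q).filter fun w => bottom col q w = i ∧ col w = i + m := by
      refine erase_eq_of_notMem fun hm => h ?_
      have := (mem_filter.1 hm).2
      omega
    rw [he, if_neg h]
    by_cases h' : i = bottom col q u ∧ m = col v - bottom col q u - 1 + 1
    · rw [if_pos (by omega), if_pos h', card_insert_of_notMem]
      exact fun h => notMem_tops_erase (mem_filter.1 h).1
    · rw [if_neg (by omega), if_neg h']

variable [Fintype V]

/-- The possible continuations of a new element `v` on top of a chain partition. -/
def continuations (col : V → ℕ) (W : Finset V) (q : V → Option V) (v : V) : Finset V :=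
  (tops W q).filter fun u => col v = col u + 1

/-- The chain partitions of `W`. -/
def chainParts (col : V → ℕ) (W : Finset V) : Finset (V → Option V) :=
  univ.filter (IsChainPart col W)

theorem mem_chainParts : q ∈ chainParts col W ↔ IsChainPart col W q := by
  simp [chainParts]

/-- Summing over the chain partitions of `W` in which `v` starts a chain. -/
theorem sum_chainParts_of_mem_tops {M : Type*} [AddCommMonoid M] (hv : v ∈ W)
    (G : (V → Option V) → M) :
    ∑ q ∈ (chainParts col W).filter (fun q => v ∈ tops W q), G q =
      ∑ q ∈ chainParts col (W.erase v), (G (Function.update q v none) +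
        ∑ u ∈ continuations col (W.erase v) q v, G (Function.update q v (some u))) := by
  have : ∀ q ∈ chainParts col (W.erase v), (G (Function.update q v none) +
        ∑ u ∈ continuations col (W.erase v) q v, G (Function.update q v (some u))) =
      ∑ x ∈ insertNone (continuations col (W.erase v) q v), G (Function.update q v x) :=
    fun q _ => by rw [sum_insertNone]
  rw [sum_congr rfl this, sum_sigma']
  have hx : ∀ q x, x ∈ insertNone (continuations col (W.erase v) q v) →
      ∀ u, x = some u → u ∈ tops (W.erase v) q ∧ col v = col u + 1 := by
    intro q x hx u hu
    rw [mem_insertNone] at hx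
    exact mem_filter.1 (hx u hu)
  refine sum_bij' (fun q _ => ⟨Function.update q v none, q v⟩)
    (fun y _ => Function.update y.1 v y.2) ?_ ?_ ?_ ?_ ?_
  · intro q hq
    obtain ⟨h1, h2⟩ := mem_filter.1 hq
    rw [mem_chainParts] at h1
    refine mem_sigma.2 ⟨mem_chainParts.2 (h1.erase h2), mem_insertNone.2 fun u hu => ?_⟩
    exact mem_filter.2 ⟨h1.mem_tops_erase hu, (h1.mem _ _ hu).2.2⟩
  · rintro ⟨q, x⟩ hq
    obtain ⟨h1, h2⟩ := mem_sigma.1 hq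
    simp only [mem_chainParts] at h1
    refine mem_filter.2 ⟨mem_chainParts.2 (h1.update hv (hx _ _ h2)), ?_⟩
    rw [h1.tops_update hv (hx _ _ h2)]
    exact mem_insert_self _ _
  · intro q hq
    simp
  · rintro ⟨q, x⟩ hq
    obtain ⟨h1, h2⟩ := mem_sigma.1 hq
    simp only [mem_chainParts] at h1
    simp only [Function.update_idem, Function.update_self]
    congr
    rw [← h1.eq_none_of_notMem, Function.update_eq_self]
  · intro q hq
    simp

end ChainPartitions

/-- Partial fraction expansion of `∏ 1/(t_u - s)` with respect to `s`. -/
theorem prod_inv_sub_eq_sum {V K : Type*} [Field K] {S : Finset V} {t : V → K} {s : K}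
    (ht : Set.InjOn t S) (hs : ∀ v ∈ S, t v ≠ s) (hS : S.Nonempty) :
    ∏ u ∈ S, (t u - s)⁻¹ = ∑ v ∈ S, (t v - s)⁻¹ * ∏ u ∈ S.erase v, (t u - t v)⁻¹ := by
  have ht' : Set.InjOn (fun v => - t v) S := fun a ha b hb h => ht ha hb (neg_injective h)
  have hx : ∀ i ∈ S, -s ≠ (fun v => - t v) i := fun i hi h => hs i hi (neg_injective h).symm
  have h := Lagrange.eval_interpolate_not_at_node (1 : V → K) hx
  rw [Lagrange.interpolate_one ht' hS, Polynomial.eval_one, Lagrange.eval_nodal] at h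
  have h0 : ∏ u ∈ S, (t u - s) ≠ 0 := prod_ne_zero_iff.2 fun u hu => sub_ne_zero.2 (hs u hu)
  rw [prod_inv_distrib, eq_comm]
  refine eq_inv_of_mul_eq_one_right ?_
  rw [h]
  congr 1
  · exact prod_congr rfl fun u _ => by ring
  · refine sum_congr rfl fun u _ => ?_
    rw [Pi.one_apply, mul_one, Lagrange.nodalWeight, mul_comm]
    congr 1
    · exact prod_congr rfl fun w _ => by congr 1; ring
    · congr 1; ring

section ChainSum

variable {V K A : Type*} [Field K] [Ring A] [Algebra K A]

/-- The factor `1/(t_v - t_{q v})` attached to a link of a chain. -/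
def linkWt (t : V → K) (q : V → Option V) (v : V) : K :=
  (q v).elim 1 fun u => (t v - t u)⁻¹

variable {r : ℕ} {col : V → ℕ} {t : V → K} {g : ℕ → A} {W : Finset V} {q : V → Option V} {v : V}

theorem IsChainPart.tops_nonempty (hq : IsChainPart col W q) (hW : W.Nonempty) :
    (tops W q).Nonempty := by
  obtain ⟨u, hu, hmax⟩ := exists_max_image W col hW
  refine ⟨u, mem_tops.2 ⟨hu, fun w hw => ?_⟩⟩
  obtain ⟨h1, -, h3⟩ := hq.mem _ _ hw
  have := hmax w h1
  omega

/-- Grouping the elements of `continuations` by the bottom of their chain. -/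
theorem IsChainPart.sum_continuations (hq : IsChainPart col W q) (f : ℕ → A) :
    ∑ u ∈ continuations col W q v, f (bottom col q u) =
      ∑ i ∈ range (col v), chainCount col W q i (col v - i - 1) • f i := by
  have hm : ∀ u ∈ continuations col W q v, bottom col q u ∈ range (col v) := by
    intro u hu
    have h1 := (mem_filter.1 hu).2
    have h2 := hq.bottom_le u
    exact mem_range.2 (by omega)
  rw [← sum_fiberwise_of_maps_to hm]
  refine sum_congr rfl fun i hi => ?_
  rw [mem_range] at hi
  have h1 : ∑ u ∈ (continuations col W q v).filter (fun u => bottom col q u = i),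
      f (bottom col q u) = ∑ u ∈ (continuations col W q v).filter
        (fun u => bottom col q u = i), f i :=
    sum_congr rfl fun u hu => by rw [(mem_filter.1 hu).2]
  rw [h1, sum_const, chainCount, continuations, filter_filter]
  congr 2
  refine filter_congr fun u _ => ?_
  constructor
  · rintro ⟨h1, h2⟩
    exact ⟨h2, by omega⟩
  · rintro ⟨h1, h2⟩
    exact ⟨by omega, h1⟩

theorem pbwPow_zero {p : ℕ → ℕ → ℕ} (hp : ∀ i m, p i m = 0) (n : ℕ) : pbwPow g r p n = 1 := by
  have h : ∀ i n, blockPow g p i n = 1 := by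
    intro i n
    induction n with
    | zero => rfl
    | succ n ih => rw [blockPow, hp, ih, pow_zero, one_mul]
  induction n with
  | zero => rfl
  | succ n ih => rw [pbwPow, h, ih, one_mul]

variable [Fintype V]

theorem prod_linkWt_update (hq : q v = none) (x : Option V) :
    ∏ w, linkWt t (Function.update q v x) w =
      (x.elim 1 fun u => (t v - t u)⁻¹) * ∏ w, linkWt t q w := by
  rw [← mul_prod_erase univ _ (mem_univ v), ← mul_prod_erase univ (linkWt t q) (mem_univ v)]
  simp only [linkWt, Function.update_self, hq, Option.elim_none, one_mul]
  congr 1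
  exact prod_congr rfl fun w hw => by rw [Function.update_of_ne (ne_of_mem_erase hw)]

/-- The sum over all chain partitions of `W` of the associated rational functions, with base
point `s`, times the associated PBW monomials. -/
def chainSum (r : ℕ) (col : V → ℕ) (t : V → K) (g : ℕ → A) (s : K) (W : Finset V) : A :=
  ∑ q ∈ chainParts col W, ((∏ v, linkWt t q v) * ∏ u ∈ tops W q, (t u - s)⁻¹) •
    pbwPow g r (chainCount col W q) r

theorem chainSum_empty (s : K) :
    chainSum r col t g s ∅ = 1 := by
  have h : chainParts col (∅ : Finset V) = {fun _ => none} := by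
    ext q
    rw [mem_chainParts, mem_singleton]
    constructor
    · intro hq
      ext1 v
      cases h : q v with
      | none => rfl
      | some u => simpa using (hq.mem _ _ h).1
    · rintro rfl
      exact ⟨by simp, by simp⟩
  rw [chainSum, h, sum_singleton, pbwPow_zero]
  · simp [linkWt, tops]
  · simp [chainCount, tops]

/-- Removing the first letter: the recursion satisfied by the chain sums. -/
theorem IsSerreA.chainSum_eq_sum (h2 : ∀ z : A, z + z = 0 → z = 0) (hg : IsSerreA g)
    (hcol : ∀ v, col v < r) (ht : Function.Injective t) {s : K} (hs : ∀ v ∈ W, t v ≠ s)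
    (hW : W.Nonempty) :
    chainSum r col t g s W =
      ∑ v ∈ W, (t v - s)⁻¹ • (chainSum r col t g (t v) (W.erase v) * g (col v)) := by
  have e1 : chainSum r col t g s W = ∑ q ∈ chainParts col W, ∑ v ∈ tops W q, (t v - s)⁻¹ •
      (((∏ w, linkWt t q w) * ∏ u ∈ (tops W q).erase v, (t u - t v)⁻¹) •
        pbwPow g r (chainCount col W q) r) := by
    refine sum_congr rfl fun q hq => ?_
    rw [mem_chainParts] at hq
    rw [prod_inv_sub_eq_sum ht.injOn (fun v hv => hs v (mem_tops.1 hv).1)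
      (hq.tops_nonempty hW), mul_sum, sum_smul]
    refine sum_congr rfl fun v _ => ?_
    rw [smul_smul]
    congr 1
    ring
  have e2 : ∀ F : (V → Option V) → V → A, ∑ q ∈ chainParts col W, ∑ v ∈ tops W q, F q v =
      ∑ v ∈ W, ∑ q ∈ (chainParts col W).filter (fun q => v ∈ tops W q), F q v := by
    intro F
    refine sum_comm' fun q v => ?_
    rw [mem_filter]
    constructor
    · rintro ⟨h1, h2⟩
      exact ⟨⟨h1, h2⟩, (mem_tops.1 h2).1⟩
    · rintro ⟨h1, h2⟩
      exact h1
  rw [e1, e2]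
  refine sum_congr rfl fun v hv => ?_
  rw [← smul_sum]
  congr 1
  rw [sum_chainParts_of_mem_tops hv, chainSum, sum_mul]
  refine sum_congr rfl fun q hq => ?_
  rw [mem_chainParts] at hq
  have hx0 : ∀ u, (none : Option V) = some u →
      u ∈ tops (W.erase v) q ∧ col v = col u + 1 := by simp
  have t0 : (tops W (Function.update q v none)).erase v = tops (W.erase v) q := by
    rw [hq.tops_update hv hx0, erase_insert]
    · exact filter_true_of_mem (by simp)
    · exact fun h => notMem_tops_erase (mem_filter.1 h).1
  have c1 : ∀ u ∈ continuations col (W.erase v) q v,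
      ((∏ w, linkWt t (Function.update q v (some u)) w) *
        ∏ u ∈ (tops W (Function.update q v (some u))).erase v, (t u - t v)⁻¹) •
          pbwPow g r (chainCount col W (Function.update q v (some u))) r =
      - (((∏ w, linkWt t q w) * ∏ u ∈ tops (W.erase v) q, (t u - t v)⁻¹) •
        pbwPow g r (lengthen (chainCount col (W.erase v) q) (bottom col q u)
          (col v - bottom col q u - 1)) r) := by
    intro u hu
    obtain ⟨hu1, hu2⟩ := mem_filter.1 hu
    have hx : ∀ w, some u = some w → w ∈ tops (W.erase v) q ∧ col v = col w + 1 := by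
      rintro w h
      cases h
      exact ⟨hu1, hu2⟩
    have t1 : (tops W (Function.update q v (some u))).erase v =
        (tops (W.erase v) q).erase u := by
      rw [hq.tops_update hv hx, erase_insert]
      · ext w
        simp only [mem_filter, mem_erase, ne_eq, Option.some_inj]
        rw [and_comm, eq_comm]
      · exact fun h => notMem_tops_erase (mem_filter.1 h).1
    rw [t1, hq.chainCount_update_some hv hu1 hu2, prod_linkWt_update hq.eq_none_of_notMem,
      ← mul_prod_erase _ _ hu1, ← neg_smul]
    congr 1
    simp only [Option.elim_some]
    rw [← neg_sub (t u) (t v), inv_neg]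
    ring
  rw [sum_congr rfl c1, t0, hq.chainCount_update_none hv, prod_linkWt_update hq.eq_none_of_notMem,
    sum_neg_distrib, ← smul_sum,
    hq.sum_continuations (v := v) (fun i => pbwPow g r (lengthen (chainCount col (W.erase v) q) i
      (col v - i - 1)) r), smul_mul_assoc, hg.pbwPow_mul h2 r _ (hcol v) (hcol v), smul_sub]
  simp [sub_eq_add_neg]

/-- The product `∏_u 1/(t_{σ u} - t_{σ (u-1)})` with `t_{σ (-1)} = s`. -/
def wordWt (t : V → K) : (n : ℕ) → K → (Fin n → V) → K
  | 0, _, _ => 1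
  | n + 1, s, σ => (t (σ 0) - s)⁻¹ * wordWt t n (t (σ 0)) (Fin.tail σ)

/-- The monomial `g_{σ (n-1)} ⋯ g_{σ 0}`. -/
def wordMon (col : V → ℕ) (g : ℕ → A) : (n : ℕ) → (Fin n → V) → A
  | 0, _ => 1
  | n + 1, σ => wordMon col g n (Fin.tail σ) * g (col (σ 0))

/-- The chain sum equals the sum over all linear orderings. -/
theorem IsSerreA.chainSum_eq_sum_words (h2 : ∀ z : A, z + z = 0 → z = 0) (hg : IsSerreA g)
    (hcol : ∀ v, col v < r) (ht : Function.Injective t) {n : ℕ} {s : K} (hs : ∀ v ∈ W, t v ≠ s)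
    (hW : W.card = n) :
    chainSum r col t g s W =
      ∑ σ ∈ univ.filter (fun σ : Fin n → V => Function.Injective σ ∧ ∀ u, σ u ∈ W),
        wordWt t n s σ • wordMon col g n σ := by
  induction n generalizing s W with
  | zero =>
    rw [card_eq_zero] at hW
    subst hW
    rw [chainSum_empty, filter_true_of_mem]
    · simp [wordWt, wordMon]
    · exact fun σ _ => ⟨Function.injective_of_subsingleton σ, fun u => u.elim0⟩
  | succ n ih =>
    have hne : W.Nonempty := card_pos.1 (by omega)
    rw [hg.chainSum_eq_sum h2 hcol ht hs hne]
    have e : ∀ v ∈ W, (t v - s)⁻¹ • (chainSum r col t g (t v) (W.erase v) * g (col v)) =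
        ∑ σ ∈ univ.filter (fun σ : Fin n → V => Function.Injective σ ∧ ∀ u, σ u ∈ W.erase v),
          wordWt t (n + 1) s (Fin.cons v σ : Fin (n + 1) → V) •
            wordMon col g (n + 1) (Fin.cons v σ : Fin (n + 1) → V) := by
      intro v hv
      rw [ih (W := W.erase v) (s := t v) (fun u hu h => ne_of_mem_erase hu (ht h))
        (by rw [card_erase_of_mem hv, hW]; rfl), sum_mul, smul_sum]
      refine sum_congr rfl fun σ _ => ?_
      simp only [wordWt, wordMon, Fin.cons_zero, Fin.tail_cons, smul_mul_assoc, smul_smul]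
    rw [sum_congr rfl e, sum_sigma']
    refine sum_bij' (fun y _ => (Fin.cons y.1 y.2 : Fin (n + 1) → V))
      (fun σ _ => ⟨σ 0, Fin.tail σ⟩) ?_ ?_ ?_ ?_ ?_
    · rintro ⟨v, σ⟩ h
      simp only [mem_sigma, mem_filter, mem_univ, true_and, mem_erase] at h ⊢
      obtain ⟨h1, h2, h3⟩ := h
      refine ⟨Fin.cons_injective_iff.2 ⟨?_, h2⟩, fun u => ?_⟩
      · rintro ⟨u, hu⟩
        exact (h3 u).1 hu
      · refine Fin.cases ?_ (fun u => ?_) u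
        · exact h1
        · rw [Fin.cons_succ]
          exact (h3 u).2
    · intro σ h
      simp only [mem_sigma, mem_filter, mem_univ, true_and, mem_erase] at h ⊢
      refine ⟨h.2 0, fun a b hab => ?_, fun u => ⟨fun hu => ?_, h.2 _⟩⟩
      · exact Fin.succ_injective _ (h.1 hab)
      · exact absurd (h.1 hu) (Fin.succ_ne_zero u)
    · rintro ⟨v, σ⟩ h
      simp
    · intro σ h
      simp
    · rintro ⟨v, σ⟩ h
      rfl

end ChainSum

section Words

theorem wordWt_eq_prod {V K : Type*} [Field K] (t : V → K) (c : ℕ → K) {n : ℕ} {s : K}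
    (σ : Fin n → V) (h0 : c 0 = s) (hc : ∀ u : Fin n, c (u + 1) = t (σ u)) :
    wordWt t n s σ = ∏ u ∈ range n, (c (u + 1) - c u)⁻¹ := by
  induction n generalizing s c with
  | zero => simp [wordWt]
  | succ n ih =>
    have h1 : c 1 = t (σ 0) := hc 0
    rw [wordWt, prod_range_succ', ih (fun u => c (u + 1)) (Fin.tail σ) h1
      (fun u => hc u.succ), mul_comm, h1, h0]

theorem wordMon_eq_prod {V A : Type*} [Ring A] (col : V → ℕ) (g : ℕ → A) {n : ℕ}
    (σ : Fin n → V) :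
    wordMon col g n σ = (List.ofFn fun u : Fin n => g (col (σ u.rev))).prod := by
  induction n with
  | zero => simp [wordMon]
  | succ n ih =>
    rw [wordMon, ih, List.ofFn_succ', List.concat_eq_append, List.prod_append,
      List.prod_singleton]
    simp only [Fin.rev_castSucc, Fin.tail, Fin.rev_last]

variable {r : ℕ} {k : Fin r → ℕ}

/-- The color of a variable. -/
def varCol (v : SVars r k) : ℕ := v.1

theorem Xv_injective : Function.Injective (Xv r k) := fun _ _ h =>
  MvPolynomial.X_injective (IsFractionRing.injective (MvPolynomial (SVars r k) ℂ) (RF r k) h)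

theorem Xv_ne_zero (v : SVars r k) : Xv r k v ≠ 0 := fun h =>
  MvPolynomial.X_ne_zero v (IsFractionRing.injective (MvPolynomial (SVars r k) ℂ) (RF r k)
    (h.trans (map_zero _).symm))

theorem card_varCol (i : Fin r) :
    (univ.filter fun v : SVars r k => v.1 = i).card = k i := by
  rw [← Fintype.card_fin (k i), ← card_univ]
  refine (card_bij (fun a _ => (⟨i, a⟩ : SVars r k)) ?_ ?_ ?_).symm
  · simp
  · intro a _ b _ h
    simpa using h
  · rintro ⟨j, a⟩ h
    simp only [mem_filter, mem_univ, true_and] at h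
    subst h
    exact ⟨a, mem_univ _, rfl⟩

variable {n : ℕ} {J : Fin n → Fin r}

theorem posCount_lt (hJ : IsContent r J k) (u : Fin n) : posCount J u < k (J u) := by
  rw [← hJ (J u)]
  refine card_lt_card (ssubset_iff_of_subset ?_ |>.2 ⟨u, by simp, by simp⟩)
  intro v hv
  simp only [mem_filter, mem_univ, true_and] at hv ⊢
  exact hv.1

theorem posCount_lt_posCount {u v : Fin n} (h : J u = J v) (huv : u < v) :
    posCount J u < posCount J v := by
  refine card_lt_card (ssubset_iff_of_subset ?_ |>.2 ⟨u, by simp [h, huv], by simp⟩)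
  intro w hw
  simp only [mem_filter, mem_univ, true_and] at hw ⊢
  exact ⟨hw.1.trans h, hw.2.trans huv⟩

/-- The variable at position `u` of the multi-index `J`. -/
def slot (hJ : IsContent r J k) (u : Fin n) : SVars r k := ⟨J u, ⟨posCount J u, posCount_lt hJ u⟩⟩

theorem slot_injective (hJ : IsContent r J k) : Function.Injective (slot hJ) := by
  intro u v h
  have h1 : J u = J v := congrArg Sigma.fst h
  have h2 : posCount J u = posCount J v :=
    congrArg (fun x : SVars r k => (x.2 : ℕ)) h
  rcases lt_trichotomy u v with h' | h' | h'
  · exact absurd h2 (posCount_lt_posCount h1 h').ne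
  · exact h'
  · exact absurd h2 (posCount_lt_posCount h1.symm h').ne'

theorem slot_bijective {J : Fin (∑ i, k i) → Fin r} (hJ : IsContent r J k) :
    Function.Bijective (slot hJ) := by
  rw [Fintype.bijective_iff_injective_and_card]
  exact ⟨slot_injective hJ, by simp⟩

theorem chainRF_succ (hJ : IsContent r J k) (π : ∀ i, Equiv.Perm (Fin (k i))) (u : Fin n) :
    chainRF r k J π (u + 1) = Xv r k (Equiv.sigmaCongrRight π (slot hJ u)) := by
  simp only [chainRF, u.2, dif_pos, Fin.eta, posCount_lt hJ u]
  rfl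

/-- A fiber-preserving permutation comes from a family of permutations of the fibers. -/
theorem exists_sigmaCongrRight {ι : Type*} {κ : ι → Type*} [∀ i, Finite (κ i)]
    (e : (Σ i, κ i) → Σ i, κ i) (he : Function.Injective e) (h1 : ∀ x, (e x).1 = x.1) :
    ∃ π : ∀ i, Equiv.Perm (κ i), ∀ x, Equiv.sigmaCongrRight π x = e x := by
  have : ∀ i a, ∃ b, e ⟨i, a⟩ = ⟨i, b⟩ := by
    intro i a
    have := h1 ⟨i, a⟩
    generalize e ⟨i, a⟩ = y at *
    obtain ⟨j, b⟩ := y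
    subst this
    exact ⟨b, rfl⟩
  choose f hf using this
  have hinj : ∀ i, Function.Injective (f i) := by
    intro i a b hab
    have := he ((hf i a).trans ((by rw [hab]) : _ = (⟨i, f i b⟩ : Σ i, κ i)) |>.trans (hf i b).symm)
    simpa using this
  refine ⟨fun i => Equiv.ofBijective (f i) (Finite.injective_iff_bijective.1 (hinj i)), ?_⟩
  rintro ⟨i, a⟩
  exact (hf i a).symm

/-- The canonical form as a sum over all linear orderings of the variables. -/
theorem sum_omegaRF_eq_sum_words {A : Type*} [Ring A] [Algebra (RF r k) A]
    (φ : FreeA r k →ₐ[RF r k] A) :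
    φ (∑ J ∈ univ.filter (fun J : Fin (∑ i, k i) → Fin r => IsContent r J k),
        algebraMap (RF r k) (FreeA r k) (omegaRF r k J) * monJ r k J) =
      ∑ σ ∈ univ.filter (fun σ : Fin (∑ i, k i) → SVars r k => Function.Injective σ),
        wordWt (Xv r k) _ 0 σ • wordMon varCol (fun a => φ (fgen r k a)) _ σ := by
  have e1 : φ (∑ J ∈ univ.filter (fun J : Fin (∑ i, k i) → Fin r => IsContent r J k),
        algebraMap (RF r k) (FreeA r k) (omegaRF r k J) * monJ r k J) =
      ∑ y ∈ univ.filter (fun J : Fin (∑ i, k i) → Fin r => IsContent r J k) ×ˢ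
        (univ : Finset (∀ i, Equiv.Perm (Fin (k i)))),
        (∏ u ∈ range (∑ i, k i), (chainRF r k y.1 y.2 (u + 1) - chainRF r k y.1 y.2 u)⁻¹) •
          φ (monJ r k y.1) := by
    rw [map_sum, sum_product]
    refine sum_congr rfl fun J _ => ?_
    rw [← Algebra.smul_def, map_smul, omegaRF, sum_smul]
  have hc : ∀ y ∈ univ.filter (fun J : Fin (∑ i, k i) → Fin r => IsContent r J k) ×ˢ
      (univ : Finset (∀ i, Equiv.Perm (Fin (k i)))), IsContent r y.1 k := fun y hy =>
    (mem_filter.1 (mem_product.1 hy).1).2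
  rw [e1]
  refine sum_bij (fun y hy u => Equiv.sigmaCongrRight y.2 (slot (hc y hy) u)) ?_ ?_ ?_ ?_
  · intro y hy
    simp only [mem_filter, mem_univ, true_and]
    exact (Equiv.injective _).comp (slot_injective (hc y hy))
  · rintro ⟨J, π⟩ hy ⟨J', π'⟩ hy' h
    have hJ : J = J' := funext fun u => congrArg Sigma.fst (congrFun h u)
    subst hJ
    congr 1
    have key : ∀ x : SVars r k, Equiv.sigmaCongrRight π x = Equiv.sigmaCongrRight π' x := by
      intro x
      obtain ⟨u, rfl⟩ := (slot_bijective (hc _ hy)).2 x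
      exact congrFun h u
    ext i a
    have := key ⟨i, a⟩
    simp only [Equiv.sigmaCongrRight_apply, Sigma.mk.injEq, heq_eq_eq,
      true_and] at this
    rw [this]
  · intro σ hσ
    simp only [mem_filter, mem_univ, true_and] at hσ
    have hb : Function.Bijective σ := by
      rw [Fintype.bijective_iff_injective_and_card]
      exact ⟨hσ, by simp⟩
    have hJ : IsContent r (fun u => (σ u).1) k := by
      intro i
      rw [← card_varCol (k := k) i]
      refine card_bij (fun u _ => σ u) (by simp) (fun a _ b _ h => hσ h) fun v hv => ?_
      obtain ⟨u, rfl⟩ := hb.2 v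
      exact ⟨u, by simpa using hv, rfl⟩
    have hs := slot_bijective hJ
    obtain ⟨π, hπ⟩ := exists_sigmaCongrRight
      (fun x => σ ((Equiv.ofBijective _ hs).symm x))
      (hσ.comp (Equiv.injective _)) fun x => by
        obtain ⟨u, rfl⟩ := hs.2 x
        rw [Equiv.ofBijective_symm_apply_apply]
        rfl
    refine ⟨(fun u => (σ u).1, π), by simpa using hJ, funext fun u => ?_⟩
    rw [hπ]
    simp
  · intro y hy
    congr 1
    · exact (wordWt_eq_prod _ (chainRF r k y.1 y.2) _ rfl (chainRF_succ (hc y hy) y.2)).symm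
    · rw [wordMon_eq_prod, monJ, map_list_prod, List.map_ofFn]
      congr 2
      funext u
      change _ = φ (fgen r k (y.1 u.rev))
      simp [fgen]

end Words

section Descent

variable {V : Type*}

/-- `v` is reached from `x` by `m` steps along its chain. -/
def Descends (q : V → Option V) : ℕ → V → V → Prop
  | 0, x, v => x = v
  | m + 1, x, v => ∃ w, Descends q m x w ∧ q w = some v

variable {col : V → ℕ} {W : Finset V} {q : V → Option V}

theorem IsChainPart.col_of_descends (hq : IsChainPart col W q) {m : ℕ} {x v : V}
    (h : Descends q m x v) : col x = col v + m := by
  induction m generalizing v with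
  | zero =>
    cases h
    rfl
  | succ m ih =>
    obtain ⟨w, hw, hwv⟩ := h
    have := ih hw
    have := (hq.mem _ _ hwv).2.2
    omega

theorem IsChainPart.bottom_of_descends (hq : IsChainPart col W q) {m : ℕ} {x v : V}
    (h : Descends q m x v) : bottom col q x = bottom col q v := by
  induction m generalizing v with
  | zero =>
    cases h
    rfl
  | succ m ih =>
    obtain ⟨w, hw, hwv⟩ := h
    rw [ih hw, hq.bottom_of_eq_some hwv]

theorem Descends.unique {m : ℕ} {x v v' : V} (h : Descends q m x v) (h' : Descends q m x v') :
    v = v' := by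
  induction m generalizing v v' with
  | zero => exact h.symm.trans h'
  | succ m ih =>
    obtain ⟨w, hw, hwv⟩ := h
    obtain ⟨w', hw', hwv'⟩ := h'
    rw [ih hw hw', hwv'] at hwv
    exact (Option.some_inj.1 hwv).symm

theorem IsChainPart.top_unique (hq : IsChainPart col W q) {m m' : ℕ} {x x' v : V}
    (hx : x ∈ tops W q) (hx' : x' ∈ tops W q)
    (h : Descends q m x v) (h' : Descends q m' x' v) : x = x' := by
  induction m generalizing v m' with
  | zero =>
    cases h
    cases m' with
    | zero => exact h'.symm
    | succ m' =>
      obtain ⟨w, -, hw⟩ := h'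
      exact absurd hw ((mem_tops.1 hx).2 w)
  | succ m ih =>
    obtain ⟨w, hw, hwv⟩ := h
    cases m' with
    | zero =>
      cases h'
      exact absurd hwv ((mem_tops.1 hx').2 w)
    | succ m' =>
      obtain ⟨w', hw', hwv'⟩ := h'
      obtain rfl := hq.inj _ _ _ hwv hwv'
      exact ih hw hw'

theorem IsChainPart.exists_top (hq : IsChainPart col W q) {v : V} (hv : v ∈ W) :
    ∃ x ∈ tops W q, ∃ m, Descends q m x v := by
  induction h : W.sup col - col v generalizing v with
  | zero =>
    refine ⟨v, mem_tops.2 ⟨hv, fun w hw => ?_⟩, 0, rfl⟩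
    obtain ⟨h1, -, h2⟩ := hq.mem _ _ hw
    have := le_sup (f := col) h1
    omega
  | succ n ih =>
    by_cases ht : ∃ w, q w = some v
    · obtain ⟨w, hw⟩ := ht
      obtain ⟨h1, -, h2⟩ := hq.mem _ _ hw
      obtain ⟨x, hx, m, hm⟩ := ih h1 (by omega)
      exact ⟨x, hx, m + 1, w, hm, hw⟩
    · push Not at ht
      exact ⟨v, mem_tops.2 ⟨hv, ht⟩, 0, rfl⟩

theorem IsChainPart.exists_descends (hq : IsChainPart col W q) {x : V} {m : ℕ}
    (h : bottom col q x + m ≤ col x) : ∃ v, Descends q m x v := by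
  induction m with
  | zero => exact ⟨x, rfl⟩
  | succ m ih =>
    obtain ⟨w, hw⟩ := ih (by omega)
    have h1 := hq.col_of_descends hw
    have h2 := hq.bottom_of_descends hw
    cases hv : q w with
    | none =>
      rw [bottom_of_eq_none hv] at h2
      omega
    | some v => exact ⟨v, w, hw, hv⟩

/-- The first element of the chain of each `v`. -/
theorem IsChainPart.exists_topOf [Fintype V] (hq : IsChainPart col univ q) :
    ∃ T : V → V, (∀ v, T v ∈ tops univ q) ∧ (∀ v, Descends q (col (T v) - col v) (T v) v) := by
  have : ∀ v, ∃ x, x ∈ tops univ q ∧ Descends q (col x - col v) x v := by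
    intro v
    obtain ⟨x, hx, m, hm⟩ := hq.exists_top (mem_univ v)
    refine ⟨x, hx, ?_⟩
    rwa [hq.col_of_descends hm, Nat.add_sub_cancel_left]
  choose T hT using this
  exact ⟨T, fun v => (hT v).1, fun v => (hT v).2⟩

end Descent

section Labellings

variable {r : ℕ} {k : Fin r → ℕ} {p : RootB r → ℕ}

/-- The chains of a PBW monomial with exponents `p`. -/
abbrev Blocks (p : RootB r → ℕ) := Σ β : RootB r, Fin (p β)

/-- The chains having an element of color `u`. -/
def cells (p : RootB r → ℕ) (u : Fin r) : Finset (Blocks p) :=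
  univ.filter fun b => (b.1.1.1 : ℕ) ≤ u ∧ (u : ℕ) < b.1.1.2

theorem mem_cells {u : Fin r} {b : Blocks p} :
    b ∈ cells p u ↔ (b.1.1.1 : ℕ) ≤ u ∧ (u : ℕ) < b.1.1.2 := by
  simp [cells]

theorem card_cells (u : Fin r) : (cells p u).card = ∑ β, p β * contB r β u := by
  rw [cells, card_filter, Fintype.sum_sigma]
  refine sum_congr rfl fun β _ => ?_
  simp only [contB]
  split_ifs <;> simp

/-- `ℓ` assigns to each variable the chain it belongs to. -/
structure IsLabelling (p : RootB r → ℕ) (ℓ : SVars r k → Blocks p) : Prop where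
  mem : ∀ v, ℓ v ∈ cells p v.1
  inj : ∀ v w, ℓ v = ℓ w → varCol v = varCol w → v = w

/-- The element following `v` in its chain. -/
def linkOf (ℓ : SVars r k → Blocks p) (v : SVars r k) : Option (SVars r k) :=
  if h : ∃ w, ℓ w = ℓ v ∧ varCol v = varCol w + 1 then some h.choose else none

variable {ℓ : SVars r k → Blocks p}

theorem IsLabelling.linkOf_eq_some (hℓ : IsLabelling p ℓ) {v w : SVars r k} :
    linkOf ℓ v = some w ↔ ℓ w = ℓ v ∧ varCol v = varCol w + 1 := by
  unfold linkOf
  split_ifs with h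
  · have h1 := h.choose_spec
    rw [Option.some_inj]
    constructor
    · rintro rfl
      exact h1
    · intro h2
      exact hℓ.inj _ _ (h1.1.trans h2.1.symm) (by omega)
  · exact ⟨fun h' => by simp at h', fun h' => absurd ⟨w, h'⟩ h⟩

theorem IsLabelling.isChainPart (hℓ : IsLabelling p ℓ) :
    IsChainPart varCol univ (linkOf ℓ) where
  mem v u h := ⟨mem_univ _, mem_univ _, (hℓ.linkOf_eq_some.1 h).2⟩
  inj v v' u h h' := by
    rw [hℓ.linkOf_eq_some] at h h'
    exact hℓ.inj _ _ (h.1.symm.trans h'.1) (by omega)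

theorem IsLabelling.card_le (hℓ : IsLabelling p ℓ) (u : Fin r) :
    Function.Injective fun a : Fin (k u) => (⟨ℓ ⟨u, a⟩, hℓ.mem ⟨u, a⟩⟩ : cells p u) := by
  intro a b h
  have := hℓ.inj ⟨u, a⟩ ⟨u, b⟩ (congrArg Subtype.val h) rfl
  simpa using this

theorem IsLabelling.exists_of_mem (hℓ : IsLabelling p ℓ)
    (hp : ∀ u : Fin r, ∑ β : RootB r, p β * contB r β u = k u) {b : Blocks p} {u : ℕ}
    (h1 : (b.1.1.1 : ℕ) ≤ u) (h2 : u < b.1.1.2) : ∃ v, ℓ v = b ∧ varCol v = u := by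
  have hu : u < r := by omega
  have hb := (Fintype.bijective_iff_injective_and_card _).2
    ⟨hℓ.card_le ⟨u, hu⟩, by rw [Fintype.card_fin, Fintype.card_coe, card_cells, hp]⟩
  obtain ⟨a, ha⟩ := hb.2 ⟨b, mem_cells.2 ⟨h1, h2⟩⟩
  exact ⟨⟨⟨u, hu⟩, a⟩, congrArg Subtype.val ha, rfl⟩

theorem IsLabelling.linkOf_eq_none (hℓ : IsLabelling p ℓ)
    (hp : ∀ u : Fin r, ∑ β : RootB r, p β * contB r β u = k u) {v : SVars r k} :
    linkOf ℓ v = none ↔ varCol v = (ℓ v).1.1.1 := by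
  have hv : _ ∧ varCol v < _ := mem_cells.1 (hℓ.mem v)
  constructor
  · intro h
    by_contra hne
    have h1 : ((ℓ v).1.1.1 : ℕ) ≤ varCol v := hv.1
    obtain ⟨w, hw, hc⟩ := hℓ.exists_of_mem hp (b := ℓ v) (u := varCol v - 1) (by omega) (by omega)
    rw [hℓ.linkOf_eq_some.2 ⟨hw, by omega⟩] at h
    cases h
  · intro h
    cases hl : linkOf ℓ v with
    | none => rfl
    | some w =>
      obtain ⟨h1, h2⟩ := hℓ.linkOf_eq_some.1 hl
      have h3 : ((ℓ w).1.1.1 : ℕ) ≤ varCol w := (mem_cells.1 (hℓ.mem w)).1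
      rw [h1] at h3
      omega

theorem IsLabelling.bottom_eq (hℓ : IsLabelling p ℓ)
    (hp : ∀ u : Fin r, ∑ β : RootB r, p β * contB r β u = k u) (v : SVars r k) :
    bottom varCol (linkOf ℓ) v = (ℓ v).1.1.1 := by
  induction h : varCol v generalizing v with
  | zero =>
    have h1 : ((ℓ v).1.1.1 : ℕ) ≤ varCol v := (mem_cells.1 (hℓ.mem v)).1
    have := hℓ.isChainPart.bottom_le v
    omega
  | succ n ih =>
    cases hl : linkOf ℓ v with
    | none => rw [bottom_of_eq_none hl, (hℓ.linkOf_eq_none hp).1 hl]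
    | some w =>
      obtain ⟨h1, h2⟩ := hℓ.linkOf_eq_some.1 hl
      rw [hℓ.isChainPart.bottom_of_eq_some hl, ih w (by omega), h1]

theorem IsLabelling.mem_tops (hℓ : IsLabelling p ℓ)
    (hp : ∀ u : Fin r, ∑ β : RootB r, p β * contB r β u = k u) {v : SVars r k} :
    v ∈ tops univ (linkOf ℓ) ↔ varCol v + 1 = (ℓ v).1.1.2 := by
  have hv : _ ∧ varCol v < _ := mem_cells.1 (hℓ.mem v)
  have h1 : ((ℓ v).1.1.1 : ℕ) ≤ varCol v := hv.1
  rw [_root_.mem_tops]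
  constructor
  · rintro ⟨-, h⟩
    by_contra hne
    obtain ⟨w, hw, hc⟩ := hℓ.exists_of_mem hp (b := ℓ v) (u := varCol v + 1) (by omega) (by omega)
    exact h w (hℓ.linkOf_eq_some.2 ⟨hw.symm, hc⟩)
  · intro h
    refine ⟨mem_univ _, fun w hw => ?_⟩
    obtain ⟨h1, h2⟩ := hℓ.linkOf_eq_some.1 hw
    have h3 : varCol w < (ℓ w).1.1.2 := (mem_cells.1 (hℓ.mem w)).2
    rw [← h1] at h3
    omega

/-- The exponents `p`, indexed by the last color and the length of the chain. -/
def expo (r : ℕ) (p : RootB r → ℕ) (i m : ℕ) : ℕ := pAtB r p i (i + m + 1)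

theorem expo_root (β : RootB r) : expo r p β.1.1 (β.1.2 - β.1.1 - 1) = p β := by
  obtain ⟨⟨⟨i, hi⟩, ⟨j, hj⟩⟩, h⟩ := β
  have h' : i < j := h
  have e : i + (j - i - 1) + 1 = j := by omega
  simp only [expo, pAtB, e]
  rw [dif_pos ⟨hi, hj, h'⟩]

theorem chainCount_eq_zero {q : SVars r k → Option (SVars r k)} {i m : ℕ} (h : r ≤ i + m) :
    chainCount varCol univ q i m = 0 := by
  rw [chainCount, card_eq_zero, filter_eq_empty_iff]
  rintro v - ⟨-, h2⟩
  have : varCol v < r := v.1.2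
  omega

theorem chainCount_eq_expo_iff {q : SVars r k → Option (SVars r k)} :
    chainCount varCol univ q = expo r p ↔
      ∀ β : RootB r, chainCount varCol univ q β.1.1 (β.1.2 - β.1.1 - 1) = p β := by
  constructor
  · intro h β
    rw [h, expo_root]
  · intro h
    ext i m
    by_cases hm : i + m < r
    · have := h ⟨(⟨i, by omega⟩, ⟨i + m + 1, by omega⟩), Fin.mk_lt_mk.2 (by omega)⟩
      rw [show i + m + 1 - i - 1 = m by omega] at this
      rw [this, expo, pAtB, dif_pos ⟨by omega, by omega, by omega⟩]
    · rw [chainCount_eq_zero (by omega), expo, pAtB, dif_neg (by omega)]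

theorem IsLabelling.chainCount_eq (hℓ : IsLabelling p ℓ)
    (hp : ∀ u : Fin r, ∑ β : RootB r, p β * contB r β u = k u) :
    chainCount varCol univ (linkOf ℓ) = expo r p := by
  rw [chainCount_eq_expo_iff]
  intro β
  have hβ : (β.1.1 : ℕ) < β.1.2 := β.2
  have hx : ∀ c : Fin (p β), ∃ v, ℓ v = ⟨β, c⟩ ∧ varCol v = β.1.2 - 1 := fun c =>
    hℓ.exists_of_mem hp (b := ⟨β, c⟩) (Nat.le_sub_one_of_lt hβ) (Nat.sub_one_lt (by omega))
  choose x hx using hx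
  rw [chainCount, ← Fintype.card_fin (p β), ← card_univ]
  refine (card_bij (fun c _ => x c) ?_ ?_ ?_).symm
  · intro c _
    rw [mem_filter, hℓ.mem_tops hp, hℓ.bottom_eq hp, (hx c).1, (hx c).2]
    exact ⟨Nat.sub_add_cancel (by omega), rfl, by omega⟩
  · intro c _ c' _ h
    have := (hx c).1
    rw [h, (hx c').1] at this
    simpa using this.symm
  · intro v hv
    rw [mem_filter, hℓ.mem_tops hp, hℓ.bottom_eq hp] at hv
    obtain ⟨h1, h2, h3⟩ := hv
    have hb : (ℓ v).1 = β := by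
      refine Subtype.ext (Prod.ext (Fin.ext h2) (Fin.ext ?_))
      omega
    obtain ⟨c, hc⟩ : ∃ c, ℓ v = ⟨β, c⟩ := by
      generalize ℓ v = b at *
      obtain ⟨b1, b2⟩ := b
      subst hb
      exact ⟨b2, rfl⟩
    refine ⟨c, mem_univ _, hℓ.inj _ _ ((hx c).1.trans hc.symm) ?_⟩
    rw [(hx c).2]
    omega

end Labellings

section Fibers

variable {r : ℕ} {k : Fin r → ℕ} {p : RootB r → ℕ}

section Tops

variable {q : SVars r k → Option (SVars r k)}

/-- The root of the chain starting at `x`. -/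
def chainRoot (hq : IsChainPart varCol univ q) (x : SVars r k) : RootB r :=
  ⟨(⟨bottom varCol q x, by
      have h1 := hq.bottom_le x
      have h2 : varCol x < r := x.1.2
      omega⟩,
    ⟨varCol x + 1, Nat.succ_lt_succ x.1.2⟩), Fin.mk_lt_mk.2 (Nat.lt_succ_of_le (hq.bottom_le x))⟩

/-- The first elements of the chains with root `β`. -/
abbrev TopsOf (hq : IsChainPart varCol univ q) (β : RootB r) :=
  {x : SVars r k // x ∈ tops univ q ∧ chainRoot hq x = β}

theorem card_TopsOf (hq : IsChainPart varCol univ q) (β : RootB r) :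
    Fintype.card (TopsOf hq β) = chainCount varCol univ q β.1.1 (β.1.2 - β.1.1 - 1) := by
  have hβ : (β.1.1 : ℕ) < β.1.2 := β.2
  rw [Fintype.card_subtype, chainCount]
  congr 1
  ext x
  simp only [mem_filter, mem_univ, true_and]
  refine and_congr_right fun _ => ?_
  rw [Subtype.ext_iff, Prod.ext_iff, Fin.ext_iff, Fin.ext_iff]
  simp only [chainRoot]
  refine and_congr_right fun _ => ?_
  omega

/-- `T` sends each element to the first element of its chain. -/
structure IsTopMap (q : SVars r k → Option (SVars r k)) (T : SVars r k → SVars r k) : Prop where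
  mem : ∀ v, T v ∈ tops univ q
  descends : ∀ v, Descends q (varCol (T v) - varCol v) (T v) v

variable {T : SVars r k → SVars r k}

theorem IsTopMap.eq_of_descends (hT : IsTopMap q T) (hq : IsChainPart varCol univ q) {m : ℕ}
    {x v : SVars r k} (hx : x ∈ tops univ q) (h : Descends q m x v) : T v = x :=
  hq.top_unique (hT.mem v) hx (hT.descends v) h

theorem IsTopMap.eq_self (hT : IsTopMap q T) (hq : IsChainPart varCol univ q)
    {x : SVars r k} (hx : x ∈ tops univ q) : T x = x :=
  hT.eq_of_descends hq (m := 0) hx rfl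

theorem IsTopMap.le (hT : IsTopMap q T) (hq : IsChainPart varCol univ q) (v : SVars r k) :
    varCol v ≤ varCol (T v) := by
  have := hq.col_of_descends (hT.descends v)
  omega

theorem IsTopMap.eq_some_iff (hT : IsTopMap q T) (hq : IsChainPart varCol univ q)
    {v w : SVars r k} : q v = some w ↔ T w = T v ∧ varCol v = varCol w + 1 := by
  constructor
  · intro h
    exact ⟨hT.eq_of_descends hq (m := varCol (T v) - varCol v + 1) (hT.mem v)
      ⟨v, hT.descends v, h⟩, (hq.mem _ _ h).2.2⟩
  · rintro ⟨h1, h2⟩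
    have h3 := hT.descends w
    have h4 := hT.le hq v
    rw [h1, show varCol (T v) - varCol w = varCol (T v) - varCol v + 1 by omega] at h3
    obtain ⟨v', h5, h6⟩ := h3
    rwa [h5.unique (hT.descends v)] at h6

/-- The labelling obtained by numbering the chains of each type. -/
def labelOf (hq : IsChainPart varCol univ q) (hT : IsTopMap q T)
    (e : ∀ β, TopsOf hq β ≃ Fin (p β)) (v : SVars r k) : Blocks p :=
  Equiv.sigmaCongrRight e ⟨chainRoot hq (T v), T v, hT.mem v, rfl⟩

variable {hq : IsChainPart varCol univ q} {hT : IsTopMap q T} {e : ∀ β, TopsOf hq β ≃ Fin (p β)}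

theorem labelOf_eq_iff {v w : SVars r k} :
    labelOf hq hT e v = labelOf hq hT e w ↔ T v = T w := by
  constructor
  · intro h
    exact congrArg (fun s : Σ β, TopsOf hq β => s.2.1) ((Equiv.sigmaCongrRight e).injective h)
  · intro h
    have : ∀ y (hy : y ∈ tops univ q), T v = y → labelOf hq hT e v =
        Equiv.sigmaCongrRight e ⟨chainRoot hq y, y, hy, rfl⟩ := by
      rintro y hy rfl
      rfl
    exact this _ (hT.mem w) h

theorem labelOf_of_mem_tops {β : RootB r} (x : TopsOf hq β) :
    labelOf hq hT e x = ⟨β, e β x⟩ := by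
  obtain ⟨x, hx, rfl⟩ := x
  have : ∀ y (hy : y ∈ tops univ q), y = x →
      Equiv.sigmaCongrRight e ⟨chainRoot hq y, y, hy, rfl⟩ =
        ⟨chainRoot hq x, e _ ⟨x, hx, rfl⟩⟩ := by
    rintro y hy rfl
    rfl
  exact this _ (hT.mem x) (hT.eq_self hq hx)

theorem isLabelling_labelOf : IsLabelling p (labelOf hq hT e) where
  mem v := by
    rw [mem_cells]
    refine ⟨?_, Nat.lt_succ_of_le (hT.le hq v)⟩
    change bottom varCol q (T v) ≤ varCol v
    rw [hq.bottom_of_descends (hT.descends v)]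
    exact hq.bottom_le v
  inj v w h hc := by
    rw [labelOf_eq_iff] at h
    have h1 := hT.descends v
    rw [h, hc] at h1
    exact h1.unique (hT.descends w)

theorem linkOf_labelOf : linkOf (labelOf hq hT e) = q := by
  ext v w
  rw [isLabelling_labelOf.linkOf_eq_some, labelOf_eq_iff, hT.eq_some_iff hq]

theorem labelOf_injective :
    Function.Injective fun e : ∀ β, TopsOf hq β ≃ Fin (p β) => labelOf hq hT e := by
  intro e e' h
  funext β
  ext x
  have := congrFun h x
  simp only [labelOf_of_mem_tops] at this
  simpa [Fin.ext_iff] using this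

end Tops

theorem Descends.label_eq {ℓ : SVars r k → Blocks p} (hℓ : IsLabelling p ℓ) {m : ℕ}
    {x v : SVars r k} (h : Descends (linkOf ℓ) m x v) : ℓ x = ℓ v := by
  induction m generalizing v with
  | zero => exact congrArg ℓ h
  | succ m ih =>
    obtain ⟨w, hw, hwv⟩ := h
    rw [ih hw, (hℓ.linkOf_eq_some.1 hwv).1]

theorem exists_eq_labelOf (hp : ∀ u : Fin r, ∑ β : RootB r, p β * contB r β u = k u)
    {ℓ : SVars r k → Blocks p} (hℓ : IsLabelling p ℓ) {q : SVars r k → Option (SVars r k)}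
    {T : SVars r k → SVars r k} (hq : IsChainPart varCol univ q) (hT : IsTopMap q T)
    (hc : chainCount varCol univ q = expo r p) (hl : linkOf ℓ = q) :
    ∃ e, labelOf hq hT e = ℓ := by
  subst hl
  have h1 : ∀ β (x : TopsOf hq β), ∃ c, ℓ x = ⟨β, c⟩ := by
    rintro β ⟨x, hx, rfl⟩
    have hb : (ℓ x).1 = chainRoot hq x := by
      refine Subtype.ext (Prod.ext (Fin.ext ?_) (Fin.ext ?_))
      · exact (hℓ.bottom_eq hp x).symm
      · exact ((hℓ.mem_tops hp).1 hx).symm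
    have h3 : ∀ (b : Blocks p) (β : RootB r), b.1 = β → ∃ c, b = ⟨β, c⟩ := by
      rintro b β rfl
      exact ⟨b.2, rfl⟩
    exact h3 _ _ hb
  choose f hf using h1
  have h2 : ∀ β, Function.Bijective (f β) := by
    intro β
    rw [Fintype.bijective_iff_injective_and_card]
    constructor
    · intro x y hxy
      have hcol : varCol x.1 = varCol y.1 :=
        Nat.succ_injective (congrArg (fun β : RootB r => (β.1.2 : ℕ)) (x.2.2.trans y.2.2.symm))
      exact Subtype.ext (hℓ.inj _ _ (by rw [hf, hf, hxy]) hcol)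
    · rw [card_TopsOf, Fintype.card_fin, hc, expo_root]
  refine ⟨fun β => Equiv.ofBijective (f β) (h2 β), ?_⟩
  funext v
  rw [← (hT.descends v).label_eq hℓ]
  exact (hf _ _).symm

/-- The number of labellings with a given underlying chain partition. -/
theorem card_labellings (hp : ∀ u : Fin r, ∑ β : RootB r, p β * contB r β u = k u)
    {q : SVars r k → Option (SVars r k)} (hq : IsChainPart varCol univ q)
    (hc : chainCount varCol univ q = expo r p) :
    (univ.filter fun ℓ : SVars r k → Blocks p => IsLabelling p ℓ ∧ linkOf ℓ = q).card =
      ∏ β, (p β).factorial := by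
  obtain ⟨T, hT1, hT2⟩ := hq.exists_topOf
  have hT : IsTopMap q T := ⟨hT1, hT2⟩
  have hcard : ∀ β, Fintype.card (TopsOf hq β) = p β := fun β => by
    rw [card_TopsOf, hc, expo_root]
  have : ∏ β, (p β).factorial = Fintype.card (∀ β, TopsOf hq β ≃ Fin (p β)) := by
    rw [Fintype.card_pi]
    refine prod_congr rfl fun β _ => ?_
    rw [Fintype.card_equiv (Fintype.equivFinOfCardEq (hcard β)), hcard]
  rw [this, ← card_univ]
  refine (card_bij (fun e _ => labelOf hq hT e) ?_ ?_ ?_).symm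
  · intro e _
    exact mem_filter.2 ⟨mem_univ _, isLabelling_labelOf, linkOf_labelOf⟩
  · intro e _ e' _ h
    exact labelOf_injective h
  · intro ℓ hℓ
    obtain ⟨-, h1, h2⟩ := mem_filter.1 hℓ
    obtain ⟨e, he⟩ := exists_eq_labelOf hp h1 hq hT hc h2
    exact ⟨e, mem_univ _, he⟩

/-- The roots of the chains of a chain partition add up to the content. -/
theorem sum_chainCount_mul_contB {q : SVars r k → Option (SVars r k)}
    (hq : IsChainPart varCol univ q) (u : Fin r) :
    ∑ β : RootB r, chainCount varCol univ q β.1.1 (β.1.2 - β.1.1 - 1) * contB r β u = k u := by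
  obtain ⟨T, hT1, hT2⟩ := hq.exists_topOf
  have hT : IsTopMap q T := ⟨hT1, hT2⟩
  set p : RootB r → ℕ := fun β => chainCount varCol univ q β.1.1 (β.1.2 - β.1.1 - 1) with hp
  let e : ∀ β, TopsOf hq β ≃ Fin (p β) := fun β => Fintype.equivFinOfCardEq (card_TopsOf hq β)
  have hℓ : IsLabelling p (labelOf hq hT e) := isLabelling_labelOf
  have hb : Function.Bijective
      fun a : Fin (k u) => (⟨labelOf hq hT e ⟨u, a⟩, hℓ.mem ⟨u, a⟩⟩ : cells p u) := by
    refine ⟨hℓ.card_le u, ?_⟩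
    rintro ⟨⟨β, c⟩, hbu⟩
    obtain ⟨x, rfl⟩ := (e β).surjective c
    obtain ⟨h1, h2⟩ := mem_cells.1 hbu
    have h3 : bottom varCol q x = β.1.1 :=
      congrArg (fun β : RootB r => (β.1.1 : ℕ)) x.2.2
    have h4 : varCol x.1 + 1 = β.1.2 :=
      congrArg (fun β : RootB r => (β.1.2 : ℕ)) x.2.2
    simp only at h1 h2
    obtain ⟨v, hv⟩ := hq.exists_descends (x := x.1) (m := varCol x.1 - u) (by omega)
    have h5 := hq.col_of_descends hv
    have h6 := hT.eq_of_descends hq x.2.1 hv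
    obtain ⟨v1, v2⟩ := v
    have h7 : v1 = u := by
      refine Fin.ext ?_
      change varCol x.1 = v1 + _ at h5
      omega
    subst h7
    refine ⟨v2, Subtype.ext ?_⟩
    simp only
    rw [← labelOf_of_mem_tops (hT := hT), labelOf_eq_iff, h6, hT.eq_self hq x.2.1]
  have := Fintype.card_of_bijective hb
  rw [Fintype.card_fin, Fintype.card_coe, card_cells] at this
  exact this.symm

end Fibers

section Coefficients

variable {r : ℕ} {k : Fin r → ℕ} {p : RootB r → ℕ}

theorem prod_Ico_chain {K : Type*} [Field K] (y : ℕ → K) {i j : ℕ} (h : i < j) :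
    ∏ u ∈ Ico i j, ((if u = i then 1 else (y u - y (u - 1))⁻¹) *
        if u + 1 = j then (y u)⁻¹ else 1) =
      (y (j - 1))⁻¹ * ∏ u ∈ Icc (i + 1) (j - 1), (y u - y (u - 1))⁻¹ := by
  rw [prod_mul_distrib, mul_comm]
  congr 1
  · rw [prod_eq_single (j - 1)]
    · rw [if_pos (by omega)]
    · intro b _ hb
      rw [if_neg (by omega)]
    · intro hj
      exact absurd (mem_Ico.2 ⟨by omega, by omega⟩) hj
  · rw [prod_eq_prod_Ico_succ_bot h, if_pos rfl, one_mul]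
    refine prod_congr (by ext; simp only [mem_Ico, mem_Icc]; omega) fun u hu => ?_
    rw [mem_Icc] at hu
    rw [if_neg (by omega)]

theorem contB_eq_one {β : RootB r} {u : Fin r} (h : (β.1.1 : ℕ) ≤ u ∧ (u : ℕ) < β.1.2) :
    contB r β u = 1 := if_pos h

theorem beforeB_trichotomy {β β' : RootB r} (h : β ≠ β') : beforeB r β β' ∨ beforeB r β' β := by
  have h1 : ¬((β.1.1 : ℕ) = β'.1.1 ∧ (β.1.2 : ℕ) = β'.1.2) := fun ⟨h1, h2⟩ =>
    h (Subtype.ext (Prod.ext (Fin.ext h1) (Fin.ext h2)))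
  unfold beforeB
  omega

theorem offB_lt_offB {β β' : RootB r} {u : Fin r} (h : beforeB r β β') {c : ℕ} (hc : c < p β)
    (hu : (β.1.1 : ℕ) ≤ u ∧ (u : ℕ) < β.1.2) (c' : ℕ) :
    offB r p β c u < offB r p β' c' u := by
  have h1 : insert β (univ.filter fun x => beforeB r x β) ⊆
      univ.filter fun x => beforeB r x β' := by
    intro x hx
    simp only [mem_insert, mem_filter, mem_univ, true_and] at hx ⊢
    rcases hx with rfl | hx
    · exact h
    · unfold beforeB at *
      omega
  have h2 := sum_le_sum_of_subset (f := fun x => p x * contB r x u) h1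
  rw [sum_insert (by simp [beforeB]), contB_eq_one hu] at h2
  unfold offB
  rw [contB_eq_one hu]
  omega

theorem offB_lt (hp : ∀ u : Fin r, ∑ β : RootB r, p β * contB r β u = k u) {β : RootB r}
    {u : Fin r} {c : ℕ} (hc : c < p β) (hu : (β.1.1 : ℕ) ≤ u ∧ (u : ℕ) < β.1.2) :
    offB r p β c u < k u := by
  have h2 := sum_le_sum_of_subset (f := fun x => p x * contB r x u)
    (subset_univ (insert β (univ.filter fun x => beforeB r x β)))
  rw [sum_insert (by simp [beforeB]), contB_eq_one hu, hp] at h2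
  unfold offB
  rw [contB_eq_one hu]
  omega

/-- The position of the color-`u` variable of each chain in the star product. -/
def placeEquiv (hp : ∀ u : Fin r, ∑ β : RootB r, p β * contB r β u = k u) (u : Fin r) :
    cells p u ≃ Fin (k u) :=
  Equiv.ofBijective (fun b => ⟨offB r p b.1.1 b.1.2 u, offB_lt hp b.1.2.2 (mem_cells.1 b.2)⟩) <| by
    rw [Fintype.bijective_iff_injective_and_card]
    refine ⟨?_, by rw [Fintype.card_coe, card_cells, hp, Fintype.card_fin]⟩
    rintro ⟨⟨β, c⟩, hb⟩ ⟨⟨β', c'⟩, hb'⟩ h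
    rw [Fin.mk.injEq] at h
    by_cases hβ : β = β'
    · subst hβ
      simp only [offB, contB_eq_one (mem_cells.1 hb)] at h
      have : c = c' := Fin.ext (by omega)
      subst this
      rfl
    · rcases beforeB_trichotomy hβ with h' | h'
      · exact absurd h (offB_lt_offB h' c.2 (mem_cells.1 hb) _).ne
      · exact absurd h (offB_lt_offB h' c'.2 (mem_cells.1 hb') _).ne'

/-- The labelling of the variables by the factors of the star product, after `π`. -/
def permLabel (hp : ∀ u : Fin r, ∑ β : RootB r, p β * contB r β u = k u)
    (π : ∀ i, Equiv.Perm (Fin (k i))) (v : SVars r k) : Blocks p :=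
  (placeEquiv hp v.1).symm ((π v.1).symm v.2)

variable (hp : ∀ u : Fin r, ∑ β : RootB r, p β * contB r β u = k u)
  (π : ∀ i, Equiv.Perm (Fin (k i)))

theorem isLabelling_permLabel : IsLabelling p (permLabel hp π) where
  mem v := Subtype.property _
  inj v w h hc := by
    obtain ⟨v1, v2⟩ := v
    obtain ⟨w1, w2⟩ := w
    obtain rfl : v1 = w1 := Fin.ext hc
    have := (π v1).symm.injective ((placeEquiv hp v1).symm.injective (Subtype.ext h))
    exact congrArg _ this

theorem tvB_permLabel (v : SVars r k) :
    tvB r k p π (permLabel hp π v).1 (permLabel hp π v).2 (varCol v + 1) 1 = Xv r k v := by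
  obtain ⟨u, a⟩ := v
  have h : placeEquiv hp u ((placeEquiv hp u).symm ((π u).symm a)) = (π u).symm a :=
    Equiv.apply_symm_apply _ _
  have h' : offB r p (permLabel hp π ⟨u, a⟩).1 (permLabel hp π ⟨u, a⟩).2 u = ((π u).symm a : ℕ) :=
    congrArg Fin.val h
  unfold tvB
  rw [dif_pos (show varCol (⟨u, a⟩ : SVars r k) + 1 - 1 < r from u.2), dif_pos (by
    change offB r p _ _ u + 0 < k u
    rw [Nat.add_zero, h']
    exact ((π u).symm a).2)]
  congr 1
  change (⟨u, π u ⟨offB r p _ _ u + 0, _⟩⟩ : SVars r k) = _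
  congr 1
  rw [← Equiv.eq_symm_apply]
  exact Fin.ext h'

theorem etaB_permLabel (b : Blocks p) :
    etaB r k p π b.1 b.2 = ∏ v ∈ univ.filter (fun v => permLabel hp π v = b),
      (linkWt (Xv r k) (linkOf (permLabel hp π)) v *
        if v ∈ tops univ (linkOf (permLabel hp π)) then (Xv r k v)⁻¹ else 1) := by
  have hℓ := isLabelling_permLabel hp π
  have hb : (b.1.1.1 : ℕ) < b.1.1.2 := b.1.2
  set y : ℕ → RF r k := fun u => tvB r k p π b.1 b.2 (u + 1) 1 with hy
  have hX : ∀ v, permLabel hp π v = b → Xv r k v = y (varCol v) := by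
    rintro v rfl
    exact (tvB_permLabel hp π v).symm
  have h1 : etaB r k p π b.1 b.2 = (y (b.1.1.2 - 1))⁻¹ *
      ∏ u ∈ Icc ((b.1.1.1 : ℕ) + 1) (b.1.1.2 - 1), (y u - y (u - 1))⁻¹ := by
    unfold etaB
    simp only [hy]
    rw [Nat.sub_add_cancel (by omega)]
    congr 1
  rw [h1, ← prod_Ico_chain y hb]
  symm
  refine prod_bij (fun v _ => varCol v) ?_ ?_ ?_ ?_
  · intro v hv
    obtain rfl := (mem_filter.1 hv).2
    exact mem_Ico.2 (mem_cells.1 (hℓ.mem v))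
  · intro v hv w hw h
    exact hℓ.inj _ _ ((mem_filter.1 hv).2.trans (mem_filter.1 hw).2.symm) h
  · intro u hu
    rw [mem_Ico] at hu
    obtain ⟨v, hv, hc⟩ := hℓ.exists_of_mem hp hu.1 hu.2
    exact ⟨v, mem_filter.2 ⟨mem_univ _, hv⟩, hc⟩
  · intro v hv
    have hv := (mem_filter.1 hv).2
    congr 1
    · have h3 := hℓ.linkOf_eq_none hp (v := v)
      rw [hv] at h3
      unfold linkWt
      cases hl : linkOf (permLabel hp π) v with
      | none => rw [if_pos (h3.1 hl), Option.elim_none]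
      | some w =>
        have h4 := hℓ.linkOf_eq_some.1 hl
        rw [if_neg (fun h => by rw [h3.2 h] at hl; cases hl), Option.elim_some, hX v hv,
          hX w (h4.1.trans hv), h4.2, Nat.add_sub_cancel]
    · rw [hX v hv]
      refine if_congr ?_ rfl rfl
      rw [hℓ.mem_tops hp, hv]

theorem prod_etaB :
    ∏ β, ∏ c ∈ range (p β), etaB r k p π β c =
      (∏ v, linkWt (Xv r k) (linkOf (permLabel hp π)) v) *
        ∏ u ∈ tops univ (linkOf (permLabel hp π)), (Xv r k u - 0)⁻¹ := by
  have h1 : ∏ β, ∏ c ∈ range (p β), etaB r k p π β c =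
      ∏ b : Blocks p, etaB r k p π b.1 b.2 := by
    rw [Fintype.prod_sigma]
    refine prod_congr rfl fun β _ => ?_
    rw [Finset.prod_range]
  rw [h1, prod_congr rfl fun b _ => etaB_permLabel hp π b, prod_fiberwise, prod_mul_distrib]
  congr 1
  rw [prod_ite_mem, univ_inter]
  simp only [sub_zero]

theorem permLabel_bijOn (ℓ : SVars r k → Blocks p) (hℓ : IsLabelling p ℓ) :
    ∃ π, permLabel hp π = ℓ := by
  have hb : ∀ u, Function.Bijective
      fun a : Fin (k u) => (⟨ℓ ⟨u, a⟩, hℓ.mem ⟨u, a⟩⟩ : cells p u) := fun u =>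
    (Fintype.bijective_iff_injective_and_card _).2
      ⟨hℓ.card_le u, by rw [Fintype.card_fin, Fintype.card_coe, card_cells, hp]⟩
  refine ⟨fun u => ((Equiv.ofBijective _ (hb u)).trans (placeEquiv hp u)).symm, ?_⟩
  funext v
  simp [permLabel]

theorem permLabel_injective : Function.Injective (permLabel hp) := by
  intro π π' h
  funext u
  have : (π u).symm = (π' u).symm := by
    ext1 a
    have := congrFun h ⟨u, a⟩
    exact (placeEquiv hp u).symm.injective (Subtype.ext this)
  rw [← (π u).symm_symm, this, Equiv.symm_symm]

/-- The coefficient `ω_p` as a sum over chain partitions. -/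
theorem omegaP_eq_sum_chainParts
    (hp : ∀ u : Fin r, ∑ β : RootB r, p β * contB r β u = k u) :
    omegaP r k p = ∑ q ∈ (chainParts varCol univ).filter
        (fun q => chainCount varCol univ q = expo r p),
      (∏ v, linkWt (Xv r k) q v) * ∏ u ∈ tops univ q, (Xv r k u - 0)⁻¹ := by
  set F : (SVars r k → Option (SVars r k)) → RF r k := fun q =>
    (∏ v, linkWt (Xv r k) q v) * ∏ u ∈ tops univ q, (Xv r k u - 0)⁻¹ with hF
  have h1 : ∑ π : ∀ i, Equiv.Perm (Fin (k i)), ∏ β, ∏ c ∈ range (p β), etaB r k p π β c =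
      ∑ ℓ ∈ univ.filter (IsLabelling (k := k) p), F (linkOf ℓ) := by
    refine sum_bij (fun π _ => permLabel hp π) ?_ ?_ ?_ ?_
    · intro π _
      exact mem_filter.2 ⟨mem_univ _, isLabelling_permLabel hp π⟩
    · intro π _ π' _ h
      exact permLabel_injective hp h
    · intro ℓ hℓ
      obtain ⟨π, hπ⟩ := permLabel_bijOn hp ℓ (mem_filter.1 hℓ).2
      exact ⟨π, mem_univ _, hπ⟩
    · intro π _
      exact prod_etaB hp π
  have hne : ((∏ β : RootB r, (p β).factorial : ℕ) : RF r k) ≠ 0 := by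
    have : CharZero (RF r k) := algebraRat.charZero _
    exact Nat.cast_ne_zero.2 (prod_ne_zero_iff.2 fun β _ => Nat.factorial_ne_zero _)
  rw [omegaP, h1, inv_mul_eq_iff_eq_mul₀ hne, mul_sum]
  rw [← sum_fiberwise_of_maps_to (s := univ.filter (IsLabelling (k := k) p)) (g := linkOf)
    (t := (chainParts varCol univ).filter fun q => chainCount varCol univ q = expo r p)]
  · refine sum_congr rfl fun q hq => ?_
    obtain ⟨hq1, hq2⟩ := mem_filter.1 hq
    rw [← card_labellings hp (mem_chainParts.1 hq1) hq2, filter_filter, ← nsmul_eq_mul]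
    refine sum_eq_card_nsmul fun ℓ hℓ => ?_
    rw [(mem_filter.1 hℓ).2.2]
  · intro ℓ hℓ
    have hℓ := (mem_filter.1 hℓ).2
    exact mem_filter.2 ⟨mem_chainParts.2 hℓ.isChainPart, hℓ.chainCount_eq hp⟩

end Coefficients

section Assembly

theorem map_lieBr {A B F : Type*} [Ring A] [Ring B] [FunLike F A B] [RingHomClass F A B]
    (φ : F) (a b : A) :
    φ (lieBr a b) = lieBr (φ a) (φ b) := by
  simp [lieBr]

theorem map_chainVec {A B : Type*} [Ring A] [Ring B] (φ : A →+* B) (g : ℕ → A) (i m : ℕ) :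
    φ (chainVec g i m) = chainVec (fun a => φ (g a)) i m := by
  induction m with
  | zero => rfl
  | succ m ih => simp only [chainVec, map_lieBr, ih]

theorem map_pbwPow {A B : Type*} [Ring A] [Ring B] (φ : A →+* B) (g : ℕ → A) (r : ℕ)
    (p : ℕ → ℕ → ℕ) (m : ℕ) : φ (pbwPow g r p m) = pbwPow (fun a => φ (g a)) r p m := by
  have h : ∀ i n, φ (blockPow g p i n) = blockPow (fun a => φ (g a)) p i n := by
    intro i n
    induction n with
    | zero => exact map_one φ
    | succ n ih => simp only [blockPow, map_mul, map_pow, map_chainVec, ih]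
  induction m with
  | zero => exact map_one φ
  | succ m ih => simp only [pbwPow, map_mul, h, ih]

variable {r : ℕ} {k : Fin r → ℕ} {p : RootB r → ℕ}

theorem listBracket_range' (i m : ℕ) :
    listBracket r k (List.range' i (m + 1)).reverse = chainVec (fgen r k) i m := by
  induction m with
  | zero => rfl
  | succ m ih =>
    rw [chainVec, ← ih, List.range'_1_concat, List.range'_1_concat]
    simp only [List.reverse_append, List.reverse_cons, List.reverse_nil, List.nil_append,
      List.cons_append, listBracket]
    rfl

theorem FpowB_eq_pbwPow : FpowB r k p = pbwPow (fgen r k) r (expo r p) r := by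
  have hb : ∀ i n, (((List.range' (i + 1) n).reverse).map fun j =>
      listBracket r k ((List.range' i (j - i)).reverse) ^ pAtB r p i j).prod =
      blockPow (fgen r k) (expo r p) i n := by
    intro i n
    induction n with
    | zero => rfl
    | succ n ih =>
      rw [List.range'_1_concat, List.reverse_append, List.map_append, List.prod_append, ih,
        blockPow]
      congr 1
      rw [List.reverse_singleton, List.map_singleton, List.prod_singleton,
        show i + 1 + n - i = n + 1 by omega, listBracket_range', expo,
        show i + n + 1 = i + 1 + n by omega]
  have hm : ∀ m, (((List.range m).reverse).map fun i =>
      (((List.range' (i + 1) (r - i)).reverse).map fun j =>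
        listBracket r k ((List.range' i (j - i)).reverse) ^ pAtB r p i j).prod).prod =
      pbwPow (fgen r k) r (expo r p) m := by
    intro m
    induction m with
    | zero => rfl
    | succ m ih =>
      rw [List.range_succ, List.reverse_append, List.map_append, List.prod_append, ih, pbwPow,
        List.reverse_singleton, List.map_singleton, List.prod_singleton, hb]
  exact hm r

/-- The exponents of the PBW monomials of content `k`. -/
abbrev Exponents (r : ℕ) (k : Fin r → ℕ) :=
  {p : RootB r → ℕ // ∀ u : Fin r, ∑ β : RootB r, p β * contB r β u = k u}

instance : Finite (Exponents r k) := by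
  have hle : ∀ (p : Exponents r k) (β : RootB r), p.1 β < ∑ i, k i + 1 := by
    intro p β
    have hβ : (β.1.1 : ℕ) < β.1.2 := β.2
    have hu : (β.1.1 : ℕ) < r := by omega
    have h1 := single_le_sum (f := fun x => p.1 x * contB r x ⟨β.1.1, hu⟩)
      (fun _ _ => Nat.zero_le _) (mem_univ β)
    rw [p.2, contB_eq_one ⟨le_rfl, hβ⟩, mul_one] at h1
    have h2 := single_le_sum (f := k) (fun _ _ => Nat.zero_le _) (mem_univ ⟨β.1.1, hu⟩)
    omega
  refine Finite.of_injective
    (fun (p : Exponents r k) (β : RootB r) => (⟨p.1 β, hle p β⟩ : Fin (∑ i, k i + 1))) ?_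
  intro p p' h
  refine Subtype.ext (funext fun β => ?_)
  simpa using congrFun h β

theorem sum_omegaP_eq_chainSum {A : Type*} [Ring A] [Algebra (RF r k) A]
    (φ : FreeA r k →ₐ[RF r k] A) :
    φ (∑ᶠ p : Exponents r k, algebraMap (RF r k) (FreeA r k) (omegaP r k p.val) *
        FpowB r k p.val) =
      chainSum r varCol (Xv r k) (fun a => φ (fgen r k a)) 0 univ := by
  have : Fintype (Exponents r k) := Fintype.ofFinite _
  rw [finsum_eq_sum_of_fintype, map_sum, chainSum]
  have h1 : ∀ p : Exponents r k,
      φ (algebraMap (RF r k) (FreeA r k) (omegaP r k p.val) * FpowB r k p.val) =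
        ∑ q ∈ chainParts varCol univ, if chainCount varCol univ q = expo r p.1 then
          ((∏ v, linkWt (Xv r k) q v) * ∏ u ∈ tops univ q, (Xv r k u - 0)⁻¹) •
            pbwPow (fun a => φ (fgen r k a)) r (chainCount varCol univ q) r else 0 := by
    intro p
    rw [map_mul, AlgHom.commutes, ← Algebra.smul_def, FpowB_eq_pbwPow,
      omegaP_eq_sum_chainParts p.2, sum_smul, ← sum_filter]
    refine sum_congr rfl fun q hq => ?_
    rw [(mem_filter.1 hq).2]
    congr 1
    exact map_pbwPow (φ : FreeA r k →+* A) _ _ _ _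
  rw [sum_congr rfl fun p _ => h1 p, sum_comm]
  refine sum_congr rfl fun q hq => ?_
  rw [mem_chainParts] at hq
  rw [Fintype.sum_eq_single ⟨_, sum_chainCount_mul_contB hq⟩]
  · rw [if_pos]
    exact chainCount_eq_expo_iff.2 fun β => rfl
  · intro p hp
    rw [if_neg]
    intro h
    exact hp (Subtype.ext (funext fun β => (chainCount_eq_expo_iff.1 h β).symm))

/-- The expansion holds in every algebra satisfying the Serre relations of type `A`. -/
theorem map_expansion {A : Type*} [Ring A] [Algebra (RF r k) A]
    (φ : FreeA r k →ₐ[RF r k] A) (hφ : IsSerreA fun a => φ (fgen r k a)) :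
    φ (∑ J ∈ univ.filter (fun J : Fin (∑ i, k i) → Fin r => IsContent r J k),
        algebraMap (RF r k) (FreeA r k) (omegaRF r k J) * monJ r k J) =
      φ (∑ᶠ p : Exponents r k, algebraMap (RF r k) (FreeA r k) (omegaP r k p.val) *
        FpowB r k p.val) := by
  have h2 : ∀ z : A, z + z = 0 → z = 0 := by
    intro z hz
    have : CharZero (RF r k) := algebraRat.charZero _
    rw [← two_smul (RF r k)] at hz
    exact (smul_eq_zero.1 hz).resolve_left two_ne_zero
  rw [sum_omegaP_eq_chainSum, sum_omegaRF_eq_sum_words,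
    hφ.chainSum_eq_sum_words h2 (col := varCol) (fun v => v.1.2) Xv_injective (fun v _ => Xv_ne_zero v)
      (n := ∑ i, k i) (by rw [card_univ]; simp)]
  simp

end Assembly

section Homogeneity

open DualNumber TrivSqZeroExt

variable {A : Type*} [Ring A]

theorem eps_pow_mul_inl_mul (u v : A) (m n : ℕ) :
    (ε ^ m * inl u : A[ε]) * (ε ^ n * inl v) = ε ^ (m + n) * inl (u * v) := by
  rw [inl_mul, pow_add, mul_assoc, mul_assoc, ← mul_assoc (inl u) (ε ^ n),
    ((commute_eps_right (inl u)).pow_right n).eq, mul_assoc]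

theorem lieBr_eps_pow (u v : A) (m n : ℕ) :
    lieBr (ε ^ m * inl u : A[ε]) (ε ^ n * inl v) = ε ^ (m + n) * inl (lieBr u v) := by
  simp only [lieBr, eps_pow_mul_inl_mul, inl_sub, mul_sub, add_comm n m]

theorem eps_pow_mul_inl_pow (u : A) (m n : ℕ) :
    (ε ^ m * inl u : A[ε]) ^ n = ε ^ (n * m) * inl (u ^ n) := by
  induction n with
  | zero => simp
  | succ n ih => rw [pow_succ, ih, eps_pow_mul_inl_mul, pow_succ, Nat.succ_mul]

/-- `1` at the last index, `0` elsewhere. -/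
def lastWt (r a : ℕ) : ℕ := if a = r - 1 then 1 else 0

variable {f : ℕ → A} {r : ℕ}

theorem chainVec_eps (hr : 0 < r) {i m : ℕ} (h : i + m < r) :
    chainVec (fun a => (ε ^ lastWt r a * inl (f a) : A[ε])) i m =
      ε ^ lastWt r (i + m) * inl (chainVec f i m) := by
  induction m with
  | zero => rfl
  | succ m ih =>
    rw [chainVec, ih (by omega), lieBr_eps_pow, chainVec]
    congr 2
    have : lastWt r (i + m) = 0 := if_neg (by omega)
    rw [this]
    rfl

theorem blockPow_eps (p : ℕ → ℕ → ℕ) {i n : ℕ} (h : i + n ≤ r) :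
    blockPow (fun a => (ε ^ lastWt r a * inl (f a) : A[ε])) p i n =
      ε ^ (∑ m ∈ range n, p i m * lastWt r (i + m)) * inl (blockPow f p i n) := by
  induction n with
  | zero => simp [blockPow]
  | succ n ih =>
    rw [blockPow, ih (by omega), chainVec_eps (by omega) (by omega), eps_pow_mul_inl_pow,
      eps_pow_mul_inl_mul, blockPow, sum_range_succ, add_comm]

theorem pbwPow_eps (p : ℕ → ℕ → ℕ) {n : ℕ} (h : n ≤ r) :
    pbwPow (fun a => (ε ^ lastWt r a * inl (f a) : A[ε])) r p n =
      ε ^ (∑ i ∈ range n, p i (r - 1 - i)) * inl (pbwPow f r p n) := by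
  induction n with
  | zero => simp [pbwPow]
  | succ n ih =>
    rw [pbwPow, ih (by omega), blockPow_eps _ (by omega), eps_pow_mul_inl_mul, pbwPow,
      sum_range_succ, add_comm]
    congr 3
    rw [sum_eq_single (r - 1 - n)]
    · rw [lastWt, if_pos (by omega), mul_one]
    · intro b _ hb
      rw [lastWt, if_neg (by omega), mul_zero]
    · intro hn
      exact absurd (mem_range.2 (by omega)) hn

end Homogeneity

section Quotient

open DualNumber TrivSqZeroExt

variable {r : ℕ} {k : Fin r → ℕ} {p : RootB r → ℕ}

theorem sum_expo (hr : 0 < r) (p : RootB r → ℕ) :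
    ∑ i ∈ range r, expo r p i (r - 1 - i) =
      ∑ β : RootB r, p β * contB r β ⟨r - 1, Nat.sub_one_lt_of_lt hr⟩ := by
  have h : ∀ β : RootB r, p β * contB r β ⟨r - 1, Nat.sub_one_lt_of_lt hr⟩ =
      if (β.1.2 : ℕ) = r then p β else 0 := by
    intro β
    have hβ : (β.1.1 : ℕ) < β.1.2 := β.2
    have := β.1.2.2
    unfold contB
    split_ifs with h1 h2 h2
    · exact mul_one _
    · simp only at h1
      omega
    · simp only at h1
      omega
    · exact mul_zero _
  rw [sum_congr rfl fun β _ => h β, ← sum_filter]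
  symm
  refine sum_bij (fun β _ => (β.1.1 : ℕ)) ?_ ?_ ?_ ?_
  · intro β _
    have hβ : (β.1.1 : ℕ) < β.1.2 := β.2
    exact mem_range.2 (by omega)
  · intro β hβ β' hβ' h
    refine Subtype.ext (Prod.ext (Fin.ext h) (Fin.ext ?_))
    exact (mem_filter.1 hβ).2.trans (mem_filter.1 hβ').2.symm
  · intro i hi
    rw [mem_range] at hi
    exact ⟨⟨(⟨i, by omega⟩, ⟨r, by omega⟩), Fin.mk_lt_mk.2 hi⟩, mem_filter.2 ⟨mem_univ _, rfl⟩, rfl⟩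
  · intro β hβ
    have hβ2 : (β.1.1 : ℕ) < β.1.2 := β.2
    rw [← expo_root (p := p) β]
    congr 1
    have := (mem_filter.1 hβ).2
    omega

/-- The quotient of the free algebra by the Serre relations of type `B_r`. -/
abbrev SerreQuot (r : ℕ) (k : Fin r → ℕ) := (TwoSidedIdeal.span (serreB r k)).ringCon.Quotient

/-- The quotient map. -/
def toSerreQuot (r : ℕ) (k : Fin r → ℕ) : FreeA r k →ₐ[RF r k] SerreQuot r k :=
  RingCon.mkₐ (RF r k) _

theorem toSerreQuot_eq_iff {x y : FreeA r k} :
    toSerreQuot r k x = toSerreQuot r k y ↔ x - y ∈ TwoSidedIdeal.span (serreB r k) := by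
  rw [← TwoSidedIdeal.rel_iff]
  exact RingCon.eq _

theorem toSerreQuot_eq_zero {x : FreeA r k} (h : x ∈ serreB r k) : toSerreQuot r k x = 0 := by
  rw [← map_zero (toSerreQuot r k), toSerreQuot_eq_iff, sub_zero]
  exact TwoSidedIdeal.subset_span h

/-- The deformation of the quotient map scaling the last generator by `ε`. -/
def epsMap (r : ℕ) (k : Fin r → ℕ) : FreeA r k →ₐ[RF r k] (SerreQuot r k)[ε] :=
  FreeAlgebra.lift (RF r k) fun a : Fin r =>
    ε ^ lastWt r a * inl (toSerreQuot r k (FreeAlgebra.ι (RF r k) a))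

theorem epsMap_fgen (a : ℕ) :
    epsMap r k (fgen r k a) = ε ^ lastWt r a * inl (toSerreQuot r k (fgen r k a)) := by
  unfold fgen
  split_ifs with h
  · exact FreeAlgebra.lift_ι_apply _ _
  · simp

theorem toSerreQuot_far {a b : ℕ} (h : a + 2 ≤ b) :
    Commute (toSerreQuot r k (fgen r k a)) (toSerreQuot r k (fgen r k b)) := by
  by_cases hb : b < r
  · rw [commute_iff_lieBr, ← map_lieBr (toSerreQuot r k)]
    refine toSerreQuot_eq_zero (Or.inl (Or.inl (Or.inl (Or.inl
      ⟨⟨a, by omega⟩, ⟨b, hb⟩, Or.inl h, ?_⟩))))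
    rw [fgen, fgen, dif_pos, dif_pos]
  · have : fgen r k b = 0 := dif_neg hb
    rw [this, map_zero]
    exact Commute.zero_right _

theorem isSerreA_epsMap (hr : 2 ≤ r) : IsSerreA fun a => epsMap r k (fgen r k a) := by
  have hcomm : ∀ (u v : SerreQuot r k) (m n : ℕ), Commute u v →
      Commute (ε ^ m * inl u : (SerreQuot r k)[ε]) (ε ^ n * inl v) := by
    intro u v m n h
    rw [Commute, SemiconjBy, eps_pow_mul_inl_mul, eps_pow_mul_inl_mul, h.eq, add_comm]
  have hzero : ∀ a, r ≤ a → fgen r k a = 0 := fun a h => dif_neg (by omega)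
  have hmap := map_lieBr (toSerreQuot r k)
  refine ⟨?_, ?_, ?_⟩
  · intro a b h
    simp only [epsMap_fgen]
    exact hcomm _ _ _ _ (toSerreQuot_far h)
  · intro a
    simp only [epsMap_fgen, lieBr_eps_pow]
    refine hcomm _ _ _ _ ?_
    rw [commute_iff_lieBr]
    rcases lt_trichotomy (a + 2) r with h | h | h
    · have := toSerreQuot_eq_zero (r := r) (k := k) (Or.inl (Or.inl (Or.inl (Or.inr
        ⟨a, by omega, rfl⟩))))
      simpa only [hmap] using this
    · obtain rfl : a = r - 2 := by omega
      have := toSerreQuot_eq_zero (r := r) (k := k) (Or.inl (Or.inr rfl))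
      rw [show r - 2 + 1 = r - 1 by omega]
      simpa only [hmap] using this
    · rw [hzero (a + 1) (by omega)]
      simp [lieBr]
  · intro a
    rw [commute_iff_lieBr]
    simp only [epsMap_fgen, lieBr_eps_pow]
    rcases lt_trichotomy (a + 2) r with h | h | h
    · have := toSerreQuot_eq_zero (r := r) (k := k) (Or.inl (Or.inl (Or.inr
        ⟨a, by omega, rfl⟩)))
      simp only [hmap] at this
      rw [this, inl_zero, mul_zero]
    · have : lastWt r (a + 1) = 1 := if_pos (by omega)
      rw [this, ← add_assoc, pow_add, ← two_mul, mul_one, eps_pow_two, zero_mul, zero_mul]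
    · rw [hzero (a + 1) (by omega)]
      simp [lieBr]

theorem epsMap_FpowB (hr : 0 < r) (hp : ∀ u : Fin r, ∑ β : RootB r, p β * contB r β u = k u) :
    epsMap r k (FpowB r k p) =
      ε ^ k ⟨r - 1, Nat.sub_one_lt_of_lt hr⟩ * inl (toSerreQuot r k (FpowB r k p)) := by
  have h1 := map_pbwPow (epsMap r k).toRingHom (fgen r k) r (expo r p) r
  have h2 := map_pbwPow (toSerreQuot r k).toRingHom (fgen r k) r (expo r p) r
  rw [FpowB_eq_pbwPow]
  refine h1.trans ?_
  rw [← hp, ← sum_expo hr]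
  refine Eq.trans ?_ (congrArg _ (congrArg inl h2.symm))
  rw [← pbwPow_eps _ le_rfl]
  congr 1
  funext a
  exact epsMap_fgen a

theorem epsMap_list_prod (l : List (Fin r)) :
    epsMap r k (l.map (FreeAlgebra.ι (RF r k))).prod =
      ε ^ (l.map fun a : Fin r => lastWt r a).sum *
        inl (toSerreQuot r k (l.map (FreeAlgebra.ι (RF r k))).prod) := by
  induction l with
  | nil => simp
  | cons a l ih =>
    rw [List.map_cons, List.prod_cons, map_mul, ih, map_mul, List.map_cons, List.sum_cons,
      ← eps_pow_mul_inl_mul]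
    congr 1
    exact FreeAlgebra.lift_ι_apply _ _

theorem epsMap_monJ (hr : 0 < r) {n : ℕ} {J : Fin n → Fin r} (hJ : IsContent r J k) :
    epsMap r k (monJ r k J) =
      ε ^ k ⟨r - 1, Nat.sub_one_lt_of_lt hr⟩ * inl (toSerreQuot r k (monJ r k J)) := by
  have h := epsMap_list_prod (k := k) (List.ofFn fun u : Fin n => J u.rev)
  have hm : (List.ofFn fun u : Fin n => J u.rev).map (FreeAlgebra.ι (RF r k)) =
      List.ofFn fun u : Fin n => FreeAlgebra.ι (RF r k) (J u.rev) := by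
    rw [List.map_ofFn]
    rfl
  rw [hm, List.map_ofFn, List.sum_ofFn] at h
  rw [monJ, h]
  congr 2
  rw [← hJ, card_filter, ← Equiv.sum_comp Fin.revPerm]
  refine sum_congr rfl fun u _ => ?_
  rw [Function.comp_apply, lastWt]
  exact if_congr (by rw [Fin.ext_iff, Fin.revPerm_apply, Fin.rev_rev]) rfl rfl

theorem epsMap_sum {ι : Type*} (s : Finset ι) (c : ι → RF r k) (x : ι → FreeA r k) {m : ℕ}
    (h : ∀ i ∈ s, epsMap r k (x i) = ε ^ m * inl (toSerreQuot r k (x i))) :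
    epsMap r k (∑ i ∈ s, algebraMap (RF r k) (FreeA r k) (c i) * x i) =
      ε ^ m * inl (toSerreQuot r k (∑ i ∈ s, algebraMap (RF r k) (FreeA r k) (c i) * x i)) := by
  simp only [← Algebra.smul_def]
  rw [map_sum, map_sum, ← inlHom_apply, map_sum, mul_sum]
  refine sum_congr rfl fun i hi => ?_
  rw [map_smul, map_smul, h i hi, inlHom_apply, inl_smul, mul_smul_comm]

end Quotient

/-- Poincaré–Birkhoff–Witt expansion of the canonical form, type `B_r`,
chain part: for `k ∈ ℕ^r` with `k_r ≤ 1`, modulo the two-sided ideal generated by the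
Serre relations, `Σ_J ω_J · f_{J(|k|)} ⋯ f_{J(1)} = Σ_p ω_p · F^p`, where `J` ranges
over the multi-indices of content `k` and `p` over the maps `{chain roots} → ℕ` with
`Σ_γ p_γ·c(γ) = k`. -/
theorem pbw_expansion_B_chain (r : ℕ) (hr : 2 ≤ r) (k : Fin r → ℕ)
    (hkr : k ⟨r - 1, by omega⟩ ≤ 1) :
    (∑ J ∈ univ.filter (fun J : Fin (∑ i, k i) → Fin r => IsContent r J k),
        algebraMap (RF r k) (FreeA r k) (omegaRF r k J) * monJ r k J) -
      (∑ᶠ p : {p : RootB r → ℕ // ∀ u : Fin r, ∑ β : RootB r, p β * contB r β u = k u},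
        algebraMap (RF r k) (FreeA r k) (omegaP r k p.val) * FpowB r k p.val) ∈
    TwoSidedIdeal.span (serreB r k) := by
  classical
  set κ := k ⟨r - 1, by omega⟩ with hκ
  have h := map_expansion (epsMap r k) (isSerreA_epsMap hr)
  have : Fintype (Exponents r k) := Fintype.ofFinite _
  rw [← toSerreQuot_eq_iff]
  rw [finsum_eq_sum_of_fintype] at h ⊢
  rw [epsMap_sum _ _ _ fun J hJ => epsMap_monJ (by omega) (mem_filter.1 hJ).2,
    epsMap_sum _ _ _ fun p _ => epsMap_FpowB (by omega) p.2] at h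
  obtain h0 | h1 : κ = 0 ∨ κ = 1 := by omega
  · rw [← hκ, h0, pow_zero, one_mul, one_mul] at h
    exact TrivSqZeroExt.inl_injective h
  · rw [← hκ, h1, pow_one] at h
    simpa using congrArg TrivSqZeroExt.snd h

end
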